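/- Let Ω ⊂ ℂ be a bounded domain whose boundary is a simple closed curve of class C^1, parametrized by γ : [0,2π] → ℂ with γ(0) = γ(2π), γ injective on [0,2π), and γ′(θ) ≠ 0 for all θ. Then a continuous function f defined on the boundary curve extends holomorphically to Ω (i.e. there exists F continuous on Ω̄ and holomorphic in Ω with F = f on the boundary) if and only if f satisfies the moment conditions ∫_0^{2π} γ(θ)^m f(γ(θ)) γ′(θ) dθ = 0 for all integers m ≥ 0. -/

import Mathlib

open Complex Set Real

noncomputable section

section

open Filter Topology MeasureTheory

/-- `γ` is a regular `C¹` map on the line, with derivative `γ'`, whose restriction to `[0, 2π]` is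
a simple closed curve parametrizing the boundary of the bounded domain `Ω`; a corner at `γ 0` is
allowed. -/
structure IsBoundaryCurve (Ω : Set ℂ) (γ γ' : ℝ → ℂ) : Prop where
  isOpen : IsOpen Ω
  isConnected : IsConnected Ω
  isBounded : Bornology.IsBounded Ω
  hasDerivAt : ∀ t, HasDerivAt γ (γ' t) t
  continuous_deriv : Continuous γ'
  deriv_ne_zero : ∀ t, γ' t ≠ 0
  closed : γ 0 = γ (2 * π)
  injOn : InjOn γ (Ico 0 (2 * π))
  image_eq : γ '' Icc 0 (2 * π) = frontier Ω

/-- The map `x + iy ↦ γ x + y κ`, straightening a neighbourhood of a piece of the curve `γ`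
transversal to the direction `κ`. -/
def tubeMap (γ : ℝ → ℂ) (κ : ℂ) (w : ℂ) : ℂ := γ w.re + (w.im : ℂ) * κ

/-- The differential of `tubeMap`. -/
def tubeDeriv (γ' : ℝ → ℂ) (κ : ℂ) (w : ℂ) : ℂ →L[ℝ] ℂ :=
  reCLM.smulRight (γ' w.re) + imCLM.smulRight κ

lemma tubeDeriv_det (γ' : ℝ → ℂ) (κ w : ℂ) :
    (tubeDeriv γ' κ w).det = (γ' w.re).re * κ.im - (γ' w.re).im * κ.re := by
  change LinearMap.det _ = _
  rw [← LinearMap.det_toMatrix Complex.basisOneI, Matrix.det_fin_two]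
  simp [LinearMap.toMatrix_apply, tubeDeriv]
  ring

namespace IsBoundaryCurve

variable {Ω : Set ℂ} {γ γ' : ℝ → ℂ}

lemma continuous (h : IsBoundaryCurve Ω γ γ') : Continuous γ :=
  continuous_iff_continuousAt.2 fun t => (h.hasDerivAt t).continuousAt

lemma exists_uniform_deriv_close (h : IsBoundaryCurve Ω γ γ') :
    ∃ δ > 0, ∀ s₀ ∈ Icc 0 (2 * π), ∀ s, |s - s₀| < δ → ‖γ' s - γ' s₀‖ ≤ ‖γ' s₀‖ / 4 := by
  have hK : IsCompact (Icc (-1) (2 * π + 1)) := isCompact_Icc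
  obtain ⟨t₀, -, ht₀⟩ := hK.exists_isMinOn ⟨0, by constructor <;> linarith [pi_pos]⟩
    (h.continuous_deriv.norm.continuousOn)
  have hm : 0 < ‖γ' t₀‖ := norm_pos_iff.2 (h.deriv_ne_zero _)
  have hu := hK.uniformContinuousOn_of_continuous h.continuous_deriv.continuousOn
  obtain ⟨δ, hδ, H⟩ := Metric.uniformContinuousOn_iff_le.1 hu (‖γ' t₀‖ / 4) (by positivity)
  refine ⟨min δ 1, by positivity, fun s₀ hs₀ s hs => ?_⟩
  have h1 := abs_lt.1 (hs.trans_le (min_le_right _ _))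
  have hs₀' : s₀ ∈ Icc (-1) (2 * π + 1) := ⟨by linarith [hs₀.1], by linarith [hs₀.2]⟩
  have := H s ⟨by linarith [hs₀.1], by linarith [hs₀.2]⟩ s₀ hs₀'
    (by rw [Real.dist_eq]; exact (hs.trans_le (min_le_left _ _)).le)
  rw [dist_eq_norm] at this
  have h2 : ‖γ' t₀‖ ≤ ‖γ' s₀‖ := ht₀ hs₀'
  linarith

lemma norm_sub_sub_le (h : IsBoundaryCurve Ω γ γ') {s₀ δ : ℝ}
    (hδ : ∀ s, |s - s₀| < δ → ‖γ' s - γ' s₀‖ ≤ ‖γ' s₀‖ / 4) {s t : ℝ}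
    (hs : |s - s₀| < δ) (ht : |t - s₀| < δ) :
    ‖γ s - γ t - (s - t : ℝ) * γ' s₀‖ ≤ ‖γ' s₀‖ / 4 * |s - t| := by
  have := Convex.norm_image_sub_le_of_norm_hasDerivWithin_le (𝕜 := ℝ)
    (f := fun s => γ s - (s : ℂ) * γ' s₀)
    (f' := fun s => γ' s - 1 * γ' s₀) (s := Metric.ball s₀ δ) (x := t) (y := s) (C := ‖γ' s₀‖ / 4)
    (fun x _ => ((h.hasDerivAt x).sub
      ((Complex.ofRealCLM.hasDerivAt (x := x)).mul_const _)).hasDerivWithinAt)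
    (fun x hx => by simpa using hδ x (by simpa [Real.dist_eq] using hx)) (convex_ball _ _)
    (by simpa [Real.dist_eq] using ht) (by simpa [Real.dist_eq] using hs)
  rw [Real.norm_eq_abs] at this
  have e : γ s - γ t - (s - t : ℝ) * γ' s₀ = γ s - s * γ' s₀ - (γ t - t * γ' s₀) := by
    push_cast; ring
  rwa [e]

lemma norm_ofReal_add_mul_I {ς : ℝ} (hς : |ς| = 1) (x y : ℝ) :
    ‖(x : ℂ) + y * (ς * I)‖ = ‖(x : ℂ) + y * I‖ := by
  have : ς ^ 2 = 1 := by rw [← sq_abs, hς]; norm_num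
  have e : (x : ℂ) + y * (ς * I) = (x : ℂ) + ((y * ς : ℝ) : ℂ) * I := by push_cast; ring
  rw [e, Complex.norm_add_mul_I, Complex.norm_add_mul_I, mul_pow, this, mul_one]

lemma tubeMap_antilipschitz (h : IsBoundaryCurve Ω γ γ') {s₀ δ ς : ℝ} (hς : |ς| = 1)
    (hδ : ∀ s, |s - s₀| < δ → ‖γ' s - γ' s₀‖ ≤ ‖γ' s₀‖ / 4) {w w' : ℂ}
    (hs : |w.re - s₀| < δ) (ht : |w'.re - s₀| < δ) :
    ‖γ' s₀‖ / 2 * ‖w - w'‖ ≤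
      ‖tubeMap γ (ς * I * γ' s₀) w - tubeMap γ (ς * I * γ' s₀) w'‖ := by
  set v := γ' s₀
  have h1 := h.norm_sub_sub_le hδ hs ht
  have e1 : ‖w - w'‖ = ‖((w.re - w'.re : ℝ) : ℂ) + (w.im - w'.im : ℝ) * (ς * I)‖ := by
    rw [norm_ofReal_add_mul_I hς]; congr 1; apply Complex.ext <;> simp
  have e2 : tubeMap γ (ς * I * v) w - tubeMap γ (ς * I * v) w' =
      (γ w.re - γ w'.re - (w.re - w'.re : ℝ) * v) +
        (((w.re - w'.re : ℝ) : ℂ) + (w.im - w'.im : ℝ) * (ς * I)) * v := by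
    simp only [tubeMap]; push_cast; ring
  have h2 : |w.re - w'.re| ≤ ‖w - w'‖ := by
    simpa using Complex.abs_re_le_norm (w - w')
  have h3 : ‖v‖ / 4 * |w.re - w'.re| ≤ ‖v‖ / 4 * ‖w - w'‖ := by gcongr
  have h4 : 0 ≤ ‖v‖ * ‖w - w'‖ := by positivity
  rw [e2]
  have h5 := norm_sub_le_norm_add ((((w.re - w'.re : ℝ) : ℂ) + (w.im - w'.im : ℝ) * (ς * I)) * v)
    (γ w.re - γ w'.re - (w.re - w'.re : ℝ) * v)
  rw [norm_mul, ← e1, add_comm] at h5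
  nlinarith

lemma hasStrictFDerivAt_tubeMap (h : IsBoundaryCurve Ω γ γ') (κ w : ℂ) :
    HasStrictFDerivAt (tubeMap γ κ) (tubeDeriv γ' κ w) w := by
  have h1 : HasStrictDerivAt γ (γ' w.re) w.re :=
    hasStrictDerivAt_of_hasDerivAt_of_continuousAt (.of_forall h.hasDerivAt)
      h.continuous_deriv.continuousAt
  have h2 := h1.hasStrictFDerivAt.comp w (reCLM.hasStrictFDerivAt)
  have h3 : HasStrictFDerivAt (fun w : ℂ => (w.im : ℂ) * κ) (imCLM.smulRight κ) w := by
    convert (imCLM.smulRight κ).hasStrictFDerivAt (x := w) using 1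
    ext w; simp
  refine (h2.add h3).congr_fderiv ?_
  ext; simp [tubeDeriv]

lemma continuous_tubeMap (h : IsBoundaryCurve Ω γ γ') (κ : ℂ) : Continuous (tubeMap γ κ) :=
  continuous_iff_continuousAt.2 fun w => (h.hasStrictFDerivAt_tubeMap κ w).continuousAt

lemma tubeDeriv_det_eq (ς : ℝ) (v w : ℂ) :
    (tubeDeriv γ' (ς * I * v) w).det = ς * (γ' w.re * (starRingEnd ℂ) v).re := by
  rw [tubeDeriv_det]; simp; ring

lemma re_mul_conj_pos (h : IsBoundaryCurve Ω γ γ') {s₀ s : ℝ}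
    (hδ : ‖γ' s - γ' s₀‖ ≤ ‖γ' s₀‖ / 4) : 0 < (γ' s * (starRingEnd ℂ) (γ' s₀)).re := by
  have hv : 0 < ‖γ' s₀‖ := norm_pos_iff.2 (h.deriv_ne_zero _)
  have e : γ' s * (starRingEnd ℂ) (γ' s₀) =
    (γ' s - γ' s₀) * (starRingEnd ℂ) (γ' s₀) + ((‖γ' s₀‖ ^ 2 : ℝ) : ℂ) := by
    rw [sub_mul, Complex.mul_conj, Complex.normSq_eq_norm_sq]; ring
  rw [e, Complex.add_re, Complex.ofReal_re]
  have := (abs_le.1 (Complex.abs_re_le_norm ((γ' s - γ' s₀) * (starRingEnd ℂ) (γ' s₀)))).1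
  rw [norm_mul, RCLike.norm_conj] at this
  nlinarith

/-- The rectangle `|x - s₀| < ρ`, `|y| < ρ`. -/
def rect (s₀ ρ : ℝ) : Set ℂ := {w | |w.re - s₀| < ρ ∧ |w.im| < ρ}

lemma isOpen_rect (s₀ ρ : ℝ) : IsOpen (rect s₀ ρ) := by
  have h1 : IsOpen {w : ℂ | |w.re - s₀| < ρ} := isOpen_lt (by fun_prop) continuous_const
  have h2 : IsOpen {w : ℂ | |w.im| < ρ} := isOpen_lt (by fun_prop) continuous_const
  exact h1.inter h2

/-- `tubeMap` with transversal direction `ς i γ'(s₀)` is a good chart around `γ s₀`, on the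
rectangle of half-width `ρ`, and `δ` controls the oscillation of `γ'`. -/
structure IsChart (γ γ' : ℝ → ℂ) (s₀ δ ρ : ℝ) : Prop where
  rho_pos : 0 < ρ
  rho_le : ρ ≤ δ
  lt_left : δ < s₀
  lt_right : s₀ + δ < 2 * π
  deriv_close : ∀ s, |s - s₀| < δ → ‖γ' s - γ' s₀‖ ≤ ‖γ' s₀‖ / 4
  far : ∃ c > 0, ∀ ς : ℝ, |ς| = 1 → ∀ w ∈ rect s₀ ρ, ∀ t ∈ Icc 0 (2 * π), δ ≤ |t - s₀| →
    c ≤ ‖γ t - tubeMap γ (ς * I * γ' s₀) w‖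

lemma eq_of_apply_eq (h : IsBoundaryCurve Ω γ γ') {s t : ℝ} (hs : s ∈ Ioo 0 (2 * π))
    (ht : t ∈ Icc 0 (2 * π)) (e : γ t = γ s) : t = s := by
  rcases eq_or_lt_of_le ht.2 with h1 | h1
  · rw [h1, ← h.closed] at e
    have := h.injOn ⟨le_rfl, by linarith [pi_pos]⟩ ⟨hs.1.le, hs.2⟩ e
    exact absurd this hs.1.ne
  · exact h.injOn ⟨ht.1, h1⟩ ⟨hs.1.le, hs.2⟩ e

lemma exists_isChart (h : IsBoundaryCurve Ω γ γ') {s₀ : ℝ} (hs₀ : s₀ ∈ Ioo 0 (2 * π)) :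
    ∃ δ ρ, IsChart γ γ' s₀ δ ρ := by
  obtain ⟨δ₁, hδ₁, H⟩ := h.exists_uniform_deriv_close
  obtain ⟨δ, hδ, hδl⟩ := exists_between (lt_min hδ₁ (lt_min hs₀.1 (sub_pos.2 hs₀.2)))
  rw [lt_min_iff, lt_min_iff] at hδl
  obtain ⟨c, hc, hfar⟩ : ∃ c > 0, ∀ t ∈ Icc 0 (2 * π), δ ≤ |t - s₀| → c ≤ ‖γ t - γ s₀‖ := by
    have hK : IsCompact (Icc 0 (2 * π) ∩ {t | δ ≤ |t - s₀|}) :=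
      isCompact_Icc.inter_right (isClosed_le continuous_const (by fun_prop))
    rcases (Icc 0 (2 * π) ∩ {t | δ ≤ |t - s₀|}).eq_empty_or_nonempty with h0 | h0
    · exact ⟨1, one_pos, fun t ht ht' => absurd (h0 ▸ ⟨ht, ht'⟩ : t ∈ (∅ : Set ℝ)) (by simp)⟩
    · obtain ⟨t₀, ht₀, hmin⟩ := hK.exists_isMinOn h0
        (f := fun t => ‖γ t - γ s₀‖) ((h.continuous.sub continuous_const).norm.continuousOn)
      refine ⟨_, norm_pos_iff.2 (sub_ne_zero.2 fun e => ?_), fun t ht ht' => hmin ⟨ht, ht'⟩⟩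
      have := h.eq_of_apply_eq hs₀ ht₀.1 e
      have h2 := ht₀.2
      rw [this] at h2; simp at h2; linarith
  have hcont : ∀ ς : ℝ, ∃ ρ > 0, ∀ w ∈ rect s₀ ρ, ‖tubeMap γ (ς * I * γ' s₀) w - γ s₀‖ < c / 2 := by
    intro ς
    have h1 := (h.continuous_tubeMap (ς * I * γ' s₀)).continuousAt (x := (s₀ : ℂ))
    obtain ⟨ε, hε, hb⟩ := Metric.continuousAt_iff.1 h1 (c / 2) (by positivity)
    refine ⟨ε / 2, by positivity, fun w hw => ?_⟩
    have := hb (x := w) ?_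
    · simpa [dist_eq_norm, tubeMap] using this
    · rw [dist_eq_norm]
      refine (Complex.norm_le_abs_re_add_abs_im _).trans_lt ?_
      have h1 := hw.1
      have h2 := hw.2
      simp only [sub_re, ofReal_re, sub_im, ofReal_im, sub_zero]
      linarith
  obtain ⟨ρ₁, hρ₁, H₁⟩ := hcont 1
  obtain ⟨ρ₂, hρ₂, H₂⟩ := hcont (-1)
  refine ⟨δ, min δ (min ρ₁ ρ₂), by positivity, min_le_left _ _, hδl.2.1, by linarith [hδl.2.2],
    fun s hs => H s₀ ⟨hs₀.1.le, hs₀.2.le⟩ s (hs.trans hδl.1), c / 2, by positivity,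
    fun ς hς w hw t ht ht' => ?_⟩
  have hw1 : w ∈ rect s₀ ρ₁ := ⟨hw.1.trans_le ((min_le_right _ _).trans (min_le_left _ _)),
    hw.2.trans_le ((min_le_right _ _).trans (min_le_left _ _))⟩
  have hw2 : w ∈ rect s₀ ρ₂ := ⟨hw.1.trans_le ((min_le_right _ _).trans (min_le_right _ _)),
    hw.2.trans_le ((min_le_right _ _).trans (min_le_right _ _))⟩
  have h3 : ‖tubeMap γ (ς * I * γ' s₀) w - γ s₀‖ < c / 2 := by
    rcases (abs_eq (by norm_num)).1 hς with rfl | rfl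
    · exact H₁ w hw1
    · exact H₂ w hw2
  have h4 := hfar t ht ht'
  have h5 := norm_sub_le_norm_sub_add_norm_sub (γ t) (tubeMap γ (ς * I * γ' s₀) w) (γ s₀)
  linarith

end IsBoundaryCurve

namespace IsBoundaryCurve

variable {Ω : Set ℂ} {γ γ' : ℝ → ℂ}

namespace IsChart

variable {s₀ δ ρ ς : ℝ}

lemma injOn (ch : IsChart γ γ' s₀ δ ρ) (h : IsBoundaryCurve Ω γ γ') (hς : |ς| = 1) :
    InjOn (tubeMap γ (ς * I * γ' s₀)) {w | |w.re - s₀| < δ} := by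
  intro w hw w' hw' e
  have := h.tubeMap_antilipschitz hς ch.deriv_close hw hw'
  rw [e, sub_self, norm_zero] at this
  have hv : 0 < ‖γ' s₀‖ := norm_pos_iff.2 (h.deriv_ne_zero _)
  have h0 : ‖w - w'‖ ≤ 0 := by
    by_contra! hcon
    have : 0 < ‖γ' s₀‖ / 2 * ‖w - w'‖ := by positivity
    linarith
  exact sub_eq_zero.1 (norm_le_zero_iff.1 h0)

lemma rect_subset (ch : IsChart γ γ' s₀ δ ρ) : rect s₀ ρ ⊆ {w | |w.re - s₀| < δ} :=
  fun _ hw => hw.1.trans_le ch.rho_le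

lemma mem_Ioo (ch : IsChart γ γ' s₀ δ ρ) {s : ℝ} (hs : |s - s₀| < δ) : s ∈ Ioo 0 (2 * π) := by
  have := abs_lt.1 hs
  exact ⟨by linarith [ch.lt_left], by linarith [ch.lt_right]⟩

lemma exists_eq_of_mem_frontier (ch : IsChart γ γ' s₀ δ ρ) (h : IsBoundaryCurve Ω γ γ')
    (hς : |ς| = 1) {w : ℂ} (hw : w ∈ rect s₀ ρ) {t : ℝ} (ht : t ∈ Icc 0 (2 * π))
    (e : γ t = tubeMap γ (ς * I * γ' s₀) w) : w = t := by
  by_cases htd : |t - s₀| < δ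
  · refine (ch.injOn h hς (x₁ := (t : ℂ)) ?_ (ch.rect_subset hw) ?_).symm
    · simpa using htd
    · rw [← e]; simp [tubeMap]
  · obtain ⟨c, hc, hfar⟩ := ch.far
    have := hfar ς hς w hw t ht (not_lt.1 htd)
    rw [e, sub_self, norm_zero] at this
    linarith

lemma mem_frontier_iff (ch : IsChart γ γ' s₀ δ ρ) (h : IsBoundaryCurve Ω γ γ')
    (hς : |ς| = 1) {w : ℂ} (hw : w ∈ rect s₀ ρ) :
    tubeMap γ (ς * I * γ' s₀) w ∈ frontier Ω ↔ w.im = 0 := by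
  rw [← h.image_eq]
  constructor
  · rintro ⟨t, ht, e⟩
    rw [ch.exists_eq_of_mem_frontier h hς hw ht e, ofReal_im]
  · intro e
    exact ⟨w.re, Ioo_subset_Icc_self (ch.mem_Ioo (ch.rect_subset hw)), by simp [tubeMap, e]⟩

lemma tubeDeriv_det_ne_zero (ch : IsChart γ γ' s₀ δ ρ) (h : IsBoundaryCurve Ω γ γ')
    (hς : |ς| = 1) {w : ℂ} (hw : |w.re - s₀| < δ) :
    (tubeDeriv γ' (ς * I * γ' s₀) w).det ≠ 0 := by
  rw [tubeDeriv_det_eq]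
  refine mul_ne_zero (fun h0 => by simp [h0] at hς) ?_
  exact (h.re_mul_conj_pos (ch.deriv_close _ hw)).ne'

lemma isOpen_image (ch : IsChart γ γ' s₀ δ ρ) (h : IsBoundaryCurve Ω γ γ')
    (hς : |ς| = 1) {S : Set ℂ} (hS : IsOpen S) (hSr : S ⊆ {w | |w.re - s₀| < δ}) :
    IsOpen (tubeMap γ (ς * I * γ' s₀) '' S) := by
  rw [isOpen_iff_mem_nhds]
  rintro _ ⟨w, hw, rfl⟩
  have hd := ch.tubeDeriv_det_ne_zero h hς (hSr hw)
  have h1 := h.hasStrictFDerivAt_tubeMap (ς * I * γ' s₀) w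
  rw [← HasStrictFDerivAt.map_nhds_eq_of_equiv
    (f' := ContinuousLinearMap.toContinuousLinearEquivOfDetNeZero _ hd) h1]
  exact image_mem_map (hS.mem_nhds hw)

lemma self_mem_rect {s₀ s r : ℝ} (hs : |s - s₀| < r) : (s : ℂ) ∈ rect s₀ r := by
  refine ⟨by simpa using hs, ?_⟩
  simpa using (abs_nonneg _).trans_lt hs

lemma image_rect_mem_nhds (ch : IsChart γ γ' s₀ δ ρ) (h : IsBoundaryCurve Ω γ γ')
    (hς : |ς| = 1) {r s : ℝ} (hr : r ≤ δ) (hs : |s - s₀| < r) :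
    tubeMap γ (ς * I * γ' s₀) '' rect s₀ r ∈ 𝓝 (γ s) :=
  (ch.isOpen_image h hς (isOpen_rect s₀ r) fun _ hw => hw.1.trans_le hr).mem_nhds
    ⟨s, self_mem_rect hs, by simp [tubeMap]⟩

end IsChart

/-- The upper half of `rect s₀ ρ`. -/
def upperRect (s₀ ρ : ℝ) : Set ℂ := {w | |w.re - s₀| < ρ ∧ 0 < w.im ∧ w.im < ρ}

lemma upperRect_subset (s₀ ρ : ℝ) : upperRect s₀ ρ ⊆ rect s₀ ρ :=
  fun _ hw => ⟨hw.1, abs_lt.2 ⟨by linarith [hw.2.1, hw.2.2], hw.2.2⟩⟩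

lemma upperRect_eq (s₀ ρ : ℝ) : upperRect s₀ ρ = Ioo (s₀ - ρ) (s₀ + ρ) ×ℂ Ioo 0 ρ := by
  ext w
  simp [upperRect, Complex.mem_reProdIm, abs_lt, sub_lt_iff_lt_add', lt_sub_iff_add_lt]

lemma isOpen_upperRect (s₀ ρ : ℝ) : IsOpen (upperRect s₀ ρ) := by
  rw [upperRect_eq]; exact isOpen_Ioo.reProdIm isOpen_Ioo

lemma isPreconnected_upperRect (s₀ ρ : ℝ) : IsPreconnected (upperRect s₀ ρ) := by
  rw [upperRect_eq]
  have h1 : Convex ℝ (reCLM ⁻¹' Ioo (s₀ - ρ) (s₀ + ρ) ∩ imCLM ⁻¹' Ioo 0 ρ) :=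
    ((convex_Ioo _ _).linear_preimage (reCLM : ℂ →ₗ[ℝ] ℝ)).inter
      ((convex_Ioo _ _).linear_preimage (imCLM : ℂ →ₗ[ℝ] ℝ))
  exact h1.isPreconnected

/-- A union of connected components of the complement of the boundary of `Ω`. -/
def IsSaturated (Ω W : Set ℂ) : Prop :=
  ∀ C : Set ℂ, IsPreconnected C → C ⊆ (frontier Ω)ᶜ → (C ∩ W).Nonempty → C ⊆ W

/-- Close to the point `γ s`, the normal in the direction `ς i γ'(s)` lies in `W`. -/
def SideIn (γ γ' : ℝ → ℂ) (W : Set ℂ) (ς s : ℝ) : Prop :=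
  ∀ᶠ τ : ℝ in 𝓝[>] 0, γ s + τ * (ς * I * γ' s) ∈ W

lemma IsChart.eventually_mem_image_upperRect {s₀ δ ρ ς : ℝ} (ch : IsChart γ γ' s₀ δ ρ)
    (h : IsBoundaryCurve Ω γ γ') (hς : |ς| = 1) {s : ℝ} (hs : |s - s₀| < ρ) :
    ∀ᶠ τ : ℝ in 𝓝[>] 0,
      γ s + τ * (ς * I * γ' s) ∈ tubeMap γ (ς * I * γ' s₀) '' upperRect s₀ ρ := by
  have hc : Tendsto (fun τ : ℝ => γ s + τ * (ς * I * γ' s)) (𝓝[>] 0) (𝓝 (γ s)) := by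
    have : Continuous (fun τ : ℝ => γ s + τ * (ς * I * γ' s)) := by fun_prop
    have h2 := this.tendsto 0
    simp only [ofReal_zero, zero_mul, add_zero] at h2
    exact h2.mono_left nhdsWithin_le_nhds
  filter_upwards [hc (ch.image_rect_mem_nhds h hς ch.rho_le hs), self_mem_nhdsWithin] with τ hτ hτ0
  obtain ⟨w, hw, e⟩ := hτ
  refine ⟨w, ⟨hw.1, ?_, (abs_lt.1 hw.2).2⟩, e⟩
  have hv : γ' s₀ ≠ 0 := h.deriv_ne_zero _
  have hsδ := hs.trans_le ch.rho_le
  have hD := h.norm_sub_sub_le ch.deriv_close hsδ (ch.rect_subset hw)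
  have hq := ch.deriv_close s hsδ
  set D := (γ s - γ w.re - (s - w.re : ℝ) * γ' s₀) / γ' s₀ with hDd
  set q := (γ' s - γ' s₀) / γ' s₀ with hqd
  have hvn : 0 < ‖γ' s₀‖ := norm_pos_iff.2 hv
  have hD' : ‖D‖ ≤ |s - w.re| / 4 := by
    rw [hDd, norm_div, div_le_iff₀ hvn]; linarith
  have hq' : ‖q‖ ≤ 1 / 4 := by
    rw [hqd, norm_div, div_le_iff₀ hvn]; linarith
  have key : ((s - w.re : ℝ) : ℂ) + D + τ * (ς * I * (1 + q)) = w.im * (ς * I) := by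
    have e' : γ w.re + (w.im : ℂ) * (ς * I * γ' s₀) = γ s + τ * (ς * I * γ' s) := e
    rw [hDd, hqd]
    field_simp
    push_cast
    linear_combination -e'
  have kre := congrArg Complex.re key
  have kim := congrArg Complex.im key
  simp at kre kim
  have hDre := abs_le.1 ((Complex.abs_re_le_norm D).trans hD')
  have hDim := abs_le.1 ((Complex.abs_im_le_norm D).trans hD')
  have hqre := abs_le.1 ((Complex.abs_re_le_norm q).trans hq')
  have hqim := abs_le.1 ((Complex.abs_im_le_norm q).trans hq')
  have hτ0 : 0 < τ := hτ0
  have hx : |s - w.re| ≤ τ / 3 := by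
    have h1 : |s - w.re| ≤ |s - w.re| / 4 + τ / 4 := by
      rcases (abs_eq (by norm_num)).1 hς with rfl | rfl
      · refine abs_le.2 ⟨?_, ?_⟩ <;> nlinarith
      · refine abs_le.2 ⟨?_, ?_⟩ <;> nlinarith
    linarith
  rcases (abs_eq (by norm_num)).1 hς with rfl | rfl
  · nlinarith
  · nlinarith

lemma IsChart.image_upperRect_subset_compl {s₀ δ ρ ς : ℝ} (ch : IsChart γ γ' s₀ δ ρ)
    (h : IsBoundaryCurve Ω γ γ') (hς : |ς| = 1) :
    tubeMap γ (ς * I * γ' s₀) '' upperRect s₀ ρ ⊆ (frontier Ω)ᶜ := by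
  rintro _ ⟨w, hw, rfl⟩ hf
  exact hw.2.1.ne' ((ch.mem_frontier_iff h hς (upperRect_subset _ _ hw)).1 hf)

lemma IsChart.isPreconnected_image_upperRect {s₀ δ ρ : ℝ} (_ : IsChart γ γ' s₀ δ ρ)
    (h : IsBoundaryCurve Ω γ γ') (κ : ℂ) : IsPreconnected (tubeMap γ κ '' upperRect s₀ ρ) :=
  (isPreconnected_upperRect s₀ ρ).image _ (h.continuous_tubeMap κ).continuousOn

lemma IsChart.sideIn_iff {s₀ δ ρ ς : ℝ} (ch : IsChart γ γ' s₀ δ ρ)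
    (h : IsBoundaryCurve Ω γ γ') (hς : |ς| = 1) {W : Set ℂ} (hW : IsSaturated Ω W)
    {s : ℝ} (hs : |s - s₀| < ρ) :
    SideIn γ γ' W ς s ↔ tubeMap γ (ς * I * γ' s₀) '' upperRect s₀ ρ ⊆ W := by
  have h1 := ch.eventually_mem_image_upperRect h hς hs
  constructor
  · intro h2
    obtain ⟨τ, hτ1, hτ2⟩ := (h1.and h2).exists
    exact hW _ (ch.isPreconnected_image_upperRect h _)
      (ch.image_upperRect_subset_compl h hς) ⟨_, hτ1, hτ2⟩
  · intro h2
    exact h1.mono fun τ hτ => h2 hτ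

lemma sideIn_of_sideIn (h : IsBoundaryCurve Ω γ γ') {ς : ℝ} (hς : |ς| = 1) {W : Set ℂ}
    (hW : IsSaturated Ω W) {s t : ℝ} (hs : s ∈ Ioo 0 (2 * π)) (ht : t ∈ Ioo 0 (2 * π))
    (hst : SideIn γ γ' W ς s) : SideIn γ γ' W ς t := by
  refine (isPreconnected_Ioo.induction₂ (fun a b => SideIn γ γ' W ς a ↔ SideIn γ γ' W ς b)
    (fun x hx => ?_) (fun _ _ _ _ _ _ => Iff.trans) (fun _ _ _ _ => Iff.symm) hs ht).1 hst
  obtain ⟨δ, ρ, ch⟩ := h.exists_isChart hx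
  have : ∀ᶠ y in 𝓝 x, |y - x| < ρ := by
    have := Metric.ball_mem_nhds x ch.rho_pos
    filter_upwards [this] with y hy
    simpa [Real.dist_eq] using hy
  refine (this.filter_mono nhdsWithin_le_nhds).mono fun y hy => ?_
  rw [ch.sideIn_iff h hς hW hy, ch.sideIn_iff h hς hW (by simpa using ch.rho_pos)]

lemma frontier_subset_closure_inter {C S : Set ℂ} (hC : IsPreconnected C) (hS : IsOpen S)
    (hCS : C ⊆ (frontier S)ᶜ) (hne : (C ∩ S).Nonempty) : C ⊆ S := by
  refine hC.subset_left_of_subset_union hS isClosed_closure.isOpen_compl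
    (disjoint_compl_right.mono_left subset_closure) (fun z hz => ?_) hne
  by_cases hzS : z ∈ S
  · exact Or.inl hzS
  · exact Or.inr fun hc => hCS hz ((hS.frontier_eq ▸ ⟨hc, hzS⟩ : z ∈ frontier S))

lemma isSaturated_self (h : IsBoundaryCurve Ω γ γ') : IsSaturated Ω Ω :=
  fun _ hC hCf hne => frontier_subset_closure_inter hC h.isOpen hCf hne

lemma isSaturated_connectedComponentIn (z : ℂ) :
    IsSaturated Ω (connectedComponentIn (frontier Ω)ᶜ z) := by
  rintro C hC hCf ⟨x, hxC, hx⟩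
  have := hC.subset_connectedComponentIn hxC hCf
  rwa [connectedComponentIn_eq hx]

end IsBoundaryCurve

/-- The Cauchy integral of the density `φ` along `γ`, without the factor `1 / 2πi`. -/
def cauchyInt (γ φ : ℝ → ℂ) (z : ℂ) : ℂ := ∫ t in (0 : ℝ)..(2 * π), φ t / (γ t - z)

namespace IsBoundaryCurve

variable {Ω : Set ℂ} {γ γ' φ : ℝ → ℂ}

lemma two_pi_nonneg : (0 : ℝ) ≤ 2 * π := by positivity

lemma mem_frontier (h : IsBoundaryCurve Ω γ γ') {t : ℝ} (ht : t ∈ Icc 0 (2 * π)) :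
    γ t ∈ frontier Ω := h.image_eq ▸ mem_image_of_mem _ ht

lemma sub_ne_zero_of_notMem (h : IsBoundaryCurve Ω γ γ') {z : ℂ} (hz : z ∉ frontier Ω) {t : ℝ}
    (ht : t ∈ Icc 0 (2 * π)) : γ t - z ≠ 0 :=
  sub_ne_zero.2 fun e => hz (e ▸ h.mem_frontier ht)

lemma isCompact_frontier (h : IsBoundaryCurve Ω γ γ') : IsCompact (frontier Ω) :=
  h.image_eq ▸ isCompact_Icc.image h.continuous

lemma exists_dist_lower_bound (h : IsBoundaryCurve Ω γ γ') {z : ℂ} (hz : z ∉ frontier Ω) :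
    ∃ r > 0, ∀ w, ‖w - z‖ < r → ∀ t ∈ Icc 0 (2 * π), r ≤ ‖γ t - w‖ := by
  have ho := (isClosed_frontier (s := Ω)).isOpen_compl
  obtain ⟨r, hr, hb⟩ := Metric.isOpen_iff.1 ho z hz
  refine ⟨r / 2, by positivity, fun w hw t ht => ?_⟩
  by_contra! hlt
  refine hb (a := γ t) ?_ (h.mem_frontier ht)
  rw [Metric.mem_ball, dist_eq_norm]
  have := norm_sub_le_norm_sub_add_norm_sub (γ t) w z
  linarith

lemma intervalIntegrable_of_continuousOn {g : ℝ → ℂ} (hg : ContinuousOn g (Icc 0 (2 * π))) :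
    IntervalIntegrable g volume 0 (2 * π) :=
  ContinuousOn.intervalIntegrable (by rwa [uIcc_of_le two_pi_nonneg])

lemma continuousOn_kernel (h : IsBoundaryCurve Ω γ γ') (hφ : ContinuousOn φ (Icc 0 (2 * π)))
    {z : ℂ} (hz : z ∉ frontier Ω) : ContinuousOn (fun t => φ t / (γ t - z)) (Icc 0 (2 * π)) :=
  hφ.div (h.continuous.continuousOn.sub continuousOn_const)
    fun _ ht => h.sub_ne_zero_of_notMem hz ht

lemma hasDerivAt_integral_kernel (h : IsBoundaryCurve Ω γ γ')
    (hφ : ContinuousOn φ (Icc 0 (2 * π))) {b : ℝ} (hb0 : b ∈ Icc 0 (2 * π))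
    {z : ℂ} (hz : z ∉ frontier Ω) :
    HasDerivAt (fun z => ∫ t in (0 : ℝ)..b, φ t / (γ t - z))
      (∫ t in (0 : ℝ)..b, φ t / (γ t - z) ^ 2) z := by
  obtain ⟨r, hr, hb⟩ := h.exists_dist_lower_bound hz
  obtain ⟨M, hM⟩ := isCompact_Icc.exists_bound_of_continuousOn hφ
  have hsub' : uIcc 0 b ⊆ Icc 0 (2 * π) := by
    rw [uIcc_of_le hb0.1]
    exact Icc_subset_Icc_right hb0.2
  have hsub : uIoc 0 b ⊆ Icc 0 (2 * π) := uIoc_subset_uIcc.trans hsub'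
  have hne : ∀ w, ‖w - z‖ < r → ∀ t ∈ Icc 0 (2 * π), γ t - w ≠ 0 := fun w hw t ht e => by
    have := hb w hw t ht
    rw [e, norm_zero] at this; linarith
  have hcont : ∀ w, ‖w - z‖ < r → ∀ n : ℕ,
      ContinuousOn (fun t => φ t / (γ t - w) ^ n) (Icc 0 (2 * π)) := fun w hw n =>
    hφ.div ((h.continuous.continuousOn.sub continuousOn_const).pow n)
      fun t ht => pow_ne_zero _ (hne w hw t ht)
  have hz0 : ‖z - z‖ < r := by simpa using hr
  have hmeas : ∀ w, ‖w - z‖ < r → ∀ n : ℕ,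
      AEStronglyMeasurable (fun t => φ t / (γ t - w) ^ n) (volume.restrict (uIoc 0 b)) :=
    fun w hw n => ((hcont w hw n).mono hsub).aestronglyMeasurable measurableSet_uIoc
  refine (intervalIntegral.hasDerivAt_integral_of_dominated_loc_of_deriv_le (𝕜 := ℂ)
    (F := fun w t => φ t / (γ t - w)) (F' := fun w t => φ t / (γ t - w) ^ 2)
    (bound := fun _ => M / r ^ 2) (Metric.ball_mem_nhds z hr) ?_ ?_ ?_ ?_ ?_ ?_).2
  · filter_upwards [Metric.ball_mem_nhds z hr] with w hw
    simpa using hmeas w (by simpa [dist_eq_norm] using hw) 1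
  · exact ContinuousOn.intervalIntegrable ((by simpa using hcont z hz0 1 :
      ContinuousOn (fun t => φ t / (γ t - z)) (Icc 0 (2 * π))).mono hsub')
  · exact hmeas z hz0 2
  · refine .of_forall fun t ht w hw => ?_
    rw [norm_div, norm_pow]
    have := hb w (by simpa [dist_eq_norm] using hw) t (hsub ht)
    have hM0 := (norm_nonneg _).trans (hM t (hsub ht))
    gcongr
    exact hM t (hsub ht)
  · exact intervalIntegrable_const
  · refine .of_forall fun t ht w hw => ?_
    have h0 := hne w (by simpa [dist_eq_norm] using hw) t (hsub ht)
    have := (((hasDerivAt_id w).const_sub (γ t)).inv h0).const_mul (φ t)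
    simpa [div_eq_mul_inv] using this

lemma hasDerivAt_cauchyInt (h : IsBoundaryCurve Ω γ γ') (hφ : ContinuousOn φ (Icc 0 (2 * π)))
    {z : ℂ} (hz : z ∉ frontier Ω) :
    HasDerivAt (cauchyInt γ φ) (∫ t in (0 : ℝ)..(2 * π), φ t / (γ t - z) ^ 2) z :=
  h.hasDerivAt_integral_kernel hφ ⟨two_pi_nonneg, le_rfl⟩ hz

lemma differentiableOn_cauchyInt (h : IsBoundaryCurve Ω γ γ')
    (hφ : ContinuousOn φ (Icc 0 (2 * π))) :
    DifferentiableOn ℂ (cauchyInt γ φ) (frontier Ω)ᶜ := fun _ hz =>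
  (h.hasDerivAt_cauchyInt hφ hz).differentiableAt.differentiableWithinAt

lemma exists_norm_le (h : IsBoundaryCurve Ω γ γ') :
    ∃ R > 0, ∀ t ∈ Icc 0 (2 * π), ‖γ t‖ ≤ R := by
  obtain ⟨R, hR⟩ := isCompact_Icc.exists_bound_of_continuousOn
    (h.continuous.continuousOn (s := Icc 0 (2 * π)))
  exact ⟨max R 1, by positivity, fun t ht => (hR t ht).trans (le_max_left _ _)⟩

lemma cauchyInt_eq_zero_of_large (h : IsBoundaryCurve Ω γ γ')
    (hφ : ContinuousOn φ (Icc 0 (2 * π)))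
    (hm : ∀ m : ℕ, ∫ t in (0 : ℝ)..(2 * π), γ t ^ m * φ t = 0) :
    ∃ R > 0, ∀ z : ℂ, R < ‖z‖ → cauchyInt γ φ z = 0 := by
  obtain ⟨R, hR, hb⟩ := h.exists_norm_le
  obtain ⟨M, hM⟩ := isCompact_Icc.exists_bound_of_continuousOn hφ
  refine ⟨R, hR, fun z hz => ?_⟩
  have hsub : uIoc 0 (2 * π) ⊆ Icc 0 (2 * π) := by
    rw [uIoc_of_le two_pi_nonneg]; exact Ioc_subset_Icc_self
  have hz0 : z ≠ 0 := norm_pos_iff.1 (hR.trans hz)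
  have hq : R / ‖z‖ < 1 := (div_lt_one (hR.trans hz)).2 hz
  have key := intervalIntegral.hasSum_integral_of_dominated_convergence (μ := volume)
    (a := 0) (b := 2 * π) (F := fun (m : ℕ) t => -(z ^ (m + 1))⁻¹ * (γ t ^ m * φ t))
    (f := fun t => φ t / (γ t - z))
    (fun m _ => M / ‖z‖ * (R / ‖z‖) ^ m) ?_ ?_ ?_ ?_ ?_
  · have h0 : ∀ m : ℕ, ∫ t in (0 : ℝ)..(2 * π), -(z ^ (m + 1))⁻¹ * (γ t ^ m * φ t) = 0 := by
      intro m
      rw [intervalIntegral.integral_const_mul, hm m, mul_zero]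
    simp only [h0] at key
    exact key.unique hasSum_zero
  · intro m
    refine ContinuousOn.aestronglyMeasurable ?_ measurableSet_uIoc
    exact continuousOn_const.mul ((h.continuous.continuousOn.pow m).mul (hφ.mono hsub))
  · refine fun m => .of_forall fun t ht => ?_
    rw [norm_mul, norm_neg, norm_inv, norm_mul, norm_pow, norm_pow]
    calc (‖z‖ ^ (m + 1))⁻¹ * (‖γ t‖ ^ m * ‖φ t‖) ≤ (‖z‖ ^ (m + 1))⁻¹ * (R ^ m * M) := by
          gcongr
          · exact hb t (hsub ht)
          · exact hM t (hsub ht)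
      _ = M / ‖z‖ * (R / ‖z‖) ^ m := by
          have : ‖z‖ ≠ 0 := (hR.trans hz).ne'
          rw [div_pow, pow_succ]
          field_simp
  · exact .of_forall fun t _ => (summable_geometric_of_lt_one (by positivity) hq).mul_left _
  · exact intervalIntegrable_const
  · refine .of_forall fun t ht => ?_
    have hlt : ‖γ t / z‖ < 1 := by
      rw [norm_div]
      exact ((div_le_div_iff_of_pos_right (hR.trans hz)).2 (hb t (hsub ht))).trans_lt hq
    have hs := (hasSum_geometric_of_norm_lt_one hlt).mul_left (-(φ t / z))
    have hne : γ t - z ≠ 0 := fun e => by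
      rw [sub_eq_zero.1 e, div_self hz0, norm_one] at hlt
      exact lt_irrefl _ hlt
    have hne' : 1 - γ t / z ≠ 0 := fun e => hne (by field_simp at e; linear_combination -e)
    have e1 : (fun m : ℕ => -(z ^ (m + 1))⁻¹ * (γ t ^ m * φ t)) =
        fun m : ℕ => -(φ t / z) * (γ t / z) ^ m := by
      funext m; rw [div_pow, pow_succ]; field_simp
    have e2 : φ t / (γ t - z) = -(φ t / z) * (1 - γ t / z)⁻¹ := by
      rw [← div_eq_mul_inv, div_eq_div_iff hne hne']
      field_simp; ring
    rw [e1, e2]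
    exact hs

lemma eqOn_zero_of_mem (h : IsBoundaryCurve Ω γ γ') (hφ : ContinuousOn φ (Icc 0 (2 * π)))
    {U : Set ℂ} (hU : IsPreconnected U) (hUf : U ⊆ (frontier Ω)ᶜ)
    {z₀ : ℂ} (hz₀ : z₀ ∈ U) (h0 : ∀ᶠ z in 𝓝 z₀, cauchyInt γ φ z = 0) :
    ∀ z ∈ U, cauchyInt γ φ z = 0 := fun _ hz =>
  ((h.differentiableOn_cauchyInt hφ).analyticOnNhd
    isClosed_frontier.isOpen_compl |>.mono hUf).eqOn_zero_of_preconnected_of_eventuallyEq_zero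
    hU hz₀ h0 hz

end IsBoundaryCurve

namespace IsBoundaryCurve

variable {Ω : Set ℂ} {γ γ' φ : ℝ → ℂ}

/-- The difference of the Cauchy kernels at two points symmetric with respect to the curve. -/
def jumpKernel (γ φ : ℝ → ℂ) (κ w : ℂ) (t : ℝ) : ℂ :=
  φ t / (γ t - tubeMap γ κ w) - φ t / (γ t - tubeMap γ κ (starRingEnd ℂ w))

lemma jumpKernel_eq {κ w : ℂ} {t : ℝ} (h1 : γ t - tubeMap γ κ w ≠ 0)
    (h2 : γ t - tubeMap γ κ (starRingEnd ℂ w) ≠ 0) :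
    jumpKernel γ φ κ w t = φ t * (2 * w.im * κ) /
      ((γ t - tubeMap γ κ w) * (γ t - tubeMap γ κ (starRingEnd ℂ w))) := by
  rw [jumpKernel, div_sub_div _ _ h1 h2]
  congr 1
  simp [tubeMap]; ring

lemma conj_mem_rect {w : ℂ} {s₀ ρ : ℝ} (hw : w ∈ rect s₀ ρ) : starRingEnd ℂ w ∈ rect s₀ ρ := by
  simpa [rect] using hw

namespace IsChart

variable {s₀ δ ρ ς : ℝ}

lemma tube_notMem_frontier (ch : IsChart γ γ' s₀ δ ρ) (h : IsBoundaryCurve Ω γ γ')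
    (hς : |ς| = 1) {w : ℂ} (hw : w ∈ rect s₀ ρ) (h0 : w.im ≠ 0) :
    tubeMap γ (ς * I * γ' s₀) w ∉ frontier Ω :=
  fun hf => h0 ((ch.mem_frontier_iff h hς hw).1 hf)

lemma eventually_mem_rect (ch : IsChart γ γ' s₀ δ ρ) : ∀ᶠ w : ℂ in 𝓝 (s₀ : ℂ), w ∈ rect s₀ ρ :=
  (isOpen_rect s₀ ρ).mem_nhds (self_mem_rect (by simpa using ch.rho_pos))

lemma tendsto_far_jump (ch : IsChart γ γ' s₀ δ ρ) (hς : |ς| = 1)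
    (hφ : ContinuousOn φ (Icc 0 (2 * π))) :
    Tendsto (fun w : ℂ => ∫ t in Ioc 0 (2 * π) \ Ioo (s₀ - δ) (s₀ + δ),
      jumpKernel γ φ (ς * I * γ' s₀) w t) (𝓝[{w | 0 < w.im}] (s₀ : ℂ)) (𝓝 0) := by
  obtain ⟨c, hc, hfar⟩ := ch.far
  obtain ⟨M, hM⟩ := isCompact_Icc.exists_bound_of_continuousOn hφ
  obtain ⟨κ, hκ⟩ : ∃ κ : ℂ, κ = ς * I * γ' s₀ := ⟨_, rfl⟩
  rw [← hκ]
  have hlim : Tendsto (fun w : ℂ => M * (2 * ‖(w.im : ℂ)‖ * ‖κ‖) / (c * c) *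
      volume.real (Ioc 0 (2 * π) \ Ioo (s₀ - δ) (s₀ + δ)))
      (𝓝[{w | 0 < w.im}] (s₀ : ℂ)) (𝓝 0) := by
    have : Continuous (fun w : ℂ => M * (2 * ‖(w.im : ℂ)‖ * ‖κ‖) / (c * c) *
      volume.real (Ioc 0 (2 * π) \ Ioo (s₀ - δ) (s₀ + δ))) := by fun_prop
    have h2 := this.tendsto (s₀ : ℂ)
    simp only [ofReal_im, ofReal_zero, norm_zero, mul_zero, zero_mul, zero_div] at h2
    exact h2.mono_left nhdsWithin_le_nhds
  refine squeeze_zero_norm' ?_ hlim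
  filter_upwards [ch.eventually_mem_rect.filter_mono nhdsWithin_le_nhds] with w hw
  refine norm_setIntegral_le_of_norm_le_const ?_ fun t ht => ?_
  · exact (measure_mono sdiff_subset).trans_lt measure_Ioc_lt_top
  · have ht1 : t ∈ Icc 0 (2 * π) := Ioc_subset_Icc_self ht.1
    have ht2 : δ ≤ |t - s₀| := by
      by_contra! hlt
      exact ht.2 ⟨by linarith [(abs_lt.1 hlt).1], by linarith [(abs_lt.1 hlt).2]⟩
    have a1 := hfar ς hς w hw t ht1 ht2
    have a2 := hfar ς hς _ (conj_mem_rect hw) t ht1 ht2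
    rw [← hκ] at a1 a2
    rw [jumpKernel_eq (norm_pos_iff.1 (hc.trans_le a1)) (norm_pos_iff.1 (hc.trans_le a2)),
      norm_div, norm_mul, norm_mul, norm_mul, norm_mul (γ t - _), Complex.norm_two]
    have hM0 := (norm_nonneg _).trans (hM t ht1)
    gcongr
    exact hM t ht1

lemma tendsto_local_jump (ch : IsChart γ γ' s₀ δ ρ) (h : IsBoundaryCurve Ω γ γ') (hς : |ς| = 1)
    (hφ : ContinuousOn φ (Icc 0 (2 * π))) :
    Tendsto (fun w : ℂ => ∫ t in Ioo (s₀ - δ) (s₀ + δ),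
      jumpKernel γ φ (ς * I * γ' s₀) w t) (𝓝[{w | 0 < w.im}] (s₀ : ℂ))
      (𝓝 (ς * (2 * π * I) * (φ s₀ / γ' s₀))) := by
  obtain ⟨M, hM⟩ := isCompact_Icc.exists_bound_of_continuousOn hφ
  obtain ⟨v, hv⟩ : ∃ v : ℂ, v = γ' s₀ := ⟨_, rfl⟩
  obtain ⟨κ, hκ⟩ : ∃ κ : ℂ, κ = ς * I * v := ⟨_, rfl⟩
  rw [← hv, ← hκ]
  have hv0 : v ≠ 0 := hv ▸ h.deriv_ne_zero _
  have hvn : 0 < ‖v‖ := norm_pos_iff.2 hv0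
  have hς2 : (ς : ℂ) ^ 2 = 1 := by
    rw [← ofReal_pow, ← sq_abs, hς]; simp
  have hκn : ‖κ‖ = ‖v‖ := by
    rw [hκ, norm_mul, norm_mul, norm_I, Complex.norm_real, Real.norm_eq_abs, hς]; ring
  have hmemS : ∀ t : ℝ, t ∈ Ioo (s₀ - δ) (s₀ + δ) ↔ |t - s₀| < δ := fun t => by
    rw [abs_lt]; constructor <;> rintro ⟨_, _⟩ <;> constructor <;> linarith
  have hδ : 0 < δ := ch.rho_pos.trans_le ch.rho_le
  have hM0 : 0 ≤ M := (norm_nonneg _).trans (hM s₀ ⟨by linarith [ch.lt_left], by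
    linarith [ch.lt_right]⟩)
  -- rescaling
  have hcv : ∀ w : ℂ, 0 < w.im → ∫ t in Ioo (s₀ - δ) (s₀ + δ), jumpKernel γ φ κ w t =
      ∫ x : ℝ, (w.im : ℂ) * (Ioo (s₀ - δ) (s₀ + δ)).indicator (jumpKernel γ φ κ w)
        (w.re + w.im * x) := by
    intro w hw
    rw [← integral_indicator measurableSet_Ioo, integral_const_mul]
    have := Measure.integral_comp_mul_left (fun y : ℝ =>
      (Ioo (s₀ - δ) (s₀ + δ)).indicator (jumpKernel γ φ κ w) (w.re + y)) w.im
    rw [this, integral_add_left_eq_self (fun y : ℝ =>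
      (Ioo (s₀ - δ) (s₀ + δ)).indicator (jumpKernel γ φ κ w) y), abs_of_pos (inv_pos.2 hw),
      Complex.real_smul, ofReal_inv, mul_inv_cancel_left₀ (by exact_mod_cast hw.ne')]
  have hval : ∫ x : ℝ, (φ s₀ * (2 * κ) / v ^ 2) * (((1 + x ^ 2)⁻¹ : ℝ) : ℂ) =
      ς * (2 * π * I) * (φ s₀ / v) := by
    rw [integral_const_mul, integral_complex_ofReal, integral_univ_inv_one_add_sq, hκ]
    field_simp
  rw [← hval]
  refine Tendsto.congr' (f₁ := fun w : ℂ => ∫ x : ℝ, (w.im : ℂ) *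
    (Ioo (s₀ - δ) (s₀ + δ)).indicator (jumpKernel γ φ κ w) (w.re + w.im * x)) ?_ ?_
  · filter_upwards [self_mem_nhdsWithin] with w hw using (hcv w hw).symm
  have hev := (ch.eventually_mem_rect.filter_mono
    (nhdsWithin_le_nhds (s := {w : ℂ | 0 < w.im}))).and self_mem_nhdsWithin
  -- lower bounds for the denominators
  have hlow : ∀ w ∈ rect s₀ ρ, 0 < w.im → ∀ x : ℝ, |w.re + w.im * x - s₀| < δ →
      ‖v‖ / 2 * (w.im * √(1 + x ^ 2)) ≤ ‖γ (w.re + w.im * x) - tubeMap γ κ w‖ := by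
    intro w hw hw0 x hx
    have := h.tubeMap_antilipschitz hς ch.deriv_close (w := ((w.re + w.im * x : ℝ) : ℂ)) (w' := w)
      (by simpa using hx) (hw.1.trans_le ch.rho_le)
    have e : ‖((w.re + w.im * x : ℝ) : ℂ) - w‖ = w.im * √(1 + x ^ 2) := by
      have e1 : ((w.re + w.im * x : ℝ) : ℂ) - w = w.im * ((x : ℂ) + ((-1 : ℝ) : ℂ) * I) := by
        apply Complex.ext <;> simp
      rw [e1, norm_mul, Complex.norm_add_mul_I, Complex.norm_real, Real.norm_of_nonneg hw0.le]
      congr 2; ring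
    rw [e] at this
    rw [← hv, ← hκ] at this
    simpa [tubeMap] using this
  have hlow' : ∀ w ∈ rect s₀ ρ, 0 < w.im → ∀ x : ℝ, |w.re + w.im * x - s₀| < δ →
      ‖v‖ / 2 * (w.im * √(1 + x ^ 2)) ≤
        ‖γ (w.re + w.im * x) - tubeMap γ κ (starRingEnd ℂ w)‖ := by
    intro w hw hw0 x hx
    have := h.tubeMap_antilipschitz hς ch.deriv_close (w := ((w.re + w.im * x : ℝ) : ℂ))
      (w' := starRingEnd ℂ w)
      (by simpa using hx) (by simpa using hw.1.trans_le ch.rho_le)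
    have e : ‖((w.re + w.im * x : ℝ) : ℂ) - starRingEnd ℂ w‖ = w.im * √(1 + x ^ 2) := by
      have e1 : ((w.re + w.im * x : ℝ) : ℂ) - starRingEnd ℂ w =
          w.im * ((x : ℂ) + ((1 : ℝ) : ℂ) * I) := by
        apply Complex.ext <;> simp
      rw [e1, norm_mul, Complex.norm_add_mul_I, Complex.norm_real, Real.norm_of_nonneg hw0.le]
      congr 2; ring
    rw [e] at this
    rw [← hv, ← hκ] at this
    simpa [tubeMap] using this
  refine tendsto_integral_filter_of_dominated_convergence
    (fun x : ℝ => M * 2 * ‖v‖ / (‖v‖ / 2) ^ 2 * (1 + x ^ 2)⁻¹) ?_ ?_ ?_ ?_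
  · filter_upwards [hev] with w hw
    have hm : AEStronglyMeasurable
        ((Ioo (s₀ - δ) (s₀ + δ)).indicator (jumpKernel γ φ κ w)) volume := by
      rw [aestronglyMeasurable_indicator_iff measurableSet_Ioo]
      refine ContinuousOn.aestronglyMeasurable ?_ measurableSet_Ioo
      have hsub : Ioo (s₀ - δ) (s₀ + δ) ⊆ Icc 0 (2 * π) := fun t ht =>
        ⟨by linarith [ht.1, ch.lt_left], by linarith [ht.2, ch.lt_right]⟩
      rw [hκ, hv]
      exact ((h.continuousOn_kernel hφ (ch.tube_notMem_frontier h hς hw.1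
        (ne_of_gt hw.2))).sub (h.continuousOn_kernel hφ (ch.tube_notMem_frontier h hς
        (conj_mem_rect hw.1) (by simpa using (ne_of_gt hw.2))))).mono hsub
    have hw2 : 0 < w.im := hw.2
    have hq : Measure.QuasiMeasurePreserving (fun x : ℝ => w.re + w.im * x) volume volume :=
      (measurePreserving_add_left volume w.re).quasiMeasurePreserving.comp
        ⟨by fun_prop, by
          rw [Real.map_volume_mul_left hw2.ne']
          exact Measure.smul_absolutelyContinuous⟩
    exact (hm.comp_quasiMeasurePreserving hq).const_mul _
  · filter_upwards [hev] with w ⟨hw, hw0⟩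
    have hw0 : 0 < w.im := hw0
    refine .of_forall fun x => ?_
    by_cases hx : |w.re + w.im * x - s₀| < δ
    · rw [indicator_of_mem ((hmemS _).2 hx)]
      have a1 := hlow w hw hw0 x hx
      have a2 := hlow' w hw hw0 x hx
      have hs : 0 < √(1 + x ^ 2) := by positivity
      have hp : 0 < ‖v‖ / 2 * (w.im * √(1 + x ^ 2)) := by positivity
      rw [jumpKernel_eq (norm_pos_iff.1 (hp.trans_le a1)) (norm_pos_iff.1 (hp.trans_le a2)),
        norm_mul, norm_div, norm_mul, norm_mul, norm_mul, norm_mul (γ _ - _), Complex.norm_two, hκn,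
        Complex.norm_real, Real.norm_of_nonneg hw0.le]
      have hMx := hM _ (Ioo_subset_Icc_self (ch.mem_Ioo hx))
      calc w.im * (‖φ (w.re + w.im * x)‖ * (2 * w.im * ‖v‖) / (‖γ (w.re + w.im * x) -
            tubeMap γ κ w‖ * ‖γ (w.re + w.im * x) - tubeMap γ κ (starRingEnd ℂ w)‖))
          ≤ w.im * (M * (2 * w.im * ‖v‖) / ((‖v‖ / 2 * (w.im * √(1 + x ^ 2))) *
            (‖v‖ / 2 * (w.im * √(1 + x ^ 2))))) := by gcongr
        _ = M * 2 * ‖v‖ / (‖v‖ / 2) ^ 2 * (1 + x ^ 2)⁻¹ := by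
            have : √(1 + x ^ 2) * √(1 + x ^ 2) = 1 + x ^ 2 := Real.mul_self_sqrt (by positivity)
            have e : (‖v‖ / 2 * (w.im * √(1 + x ^ 2))) * (‖v‖ / 2 * (w.im * √(1 + x ^ 2))) =
              (‖v‖ / 2) ^ 2 * w.im ^ 2 * (1 + x ^ 2) := by
              linear_combination (‖v‖ / 2) ^ 2 * w.im ^ 2 * this
            rw [e]; field_simp
    · rw [indicator_of_notMem (fun hh => hx ((hmemS _).1 hh)), mul_zero, norm_zero]
      positivity
  · exact integrable_inv_one_add_sq.const_mul _
  · refine .of_forall fun x => ?_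
    have hcx : Tendsto (fun w : ℂ => w.re + w.im * x) (𝓝[{w : ℂ | 0 < w.im}] (s₀ : ℂ))
        (𝓝 s₀) := by
      have : Continuous (fun w : ℂ => w.re + w.im * x) := by fun_prop
      have h2 := this.tendsto (s₀ : ℂ)
      simp only [ofReal_re, ofReal_im, zero_mul, add_zero] at h2
      exact h2.mono_left nhdsWithin_le_nhds
    have hre : Tendsto (fun w : ℂ => w.re) (𝓝[{w : ℂ | 0 < w.im}] (s₀ : ℂ)) (𝓝 s₀) := by
      have h2 := Complex.continuous_re.tendsto (s₀ : ℂ)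
      simp only [ofReal_re] at h2
      exact h2.mono_left nhdsWithin_le_nhds
    have hd : HasStrictDerivAt γ v s₀ := hv ▸
      hasStrictDerivAt_of_hasDerivAt_of_continuousAt (.of_forall h.hasDerivAt)
        h.continuous_deriv.continuousAt
    have hq : Tendsto (fun w : ℂ => (γ (w.re + w.im * x) - γ w.re) / w.im)
        (𝓝[{w : ℂ | 0 < w.im}] (s₀ : ℂ)) (𝓝 (x * v)) := by
      have h1 := (hd.hasStrictFDerivAt.isLittleO.comp_tendsto (hcx.prodMk_nhds hre))
      have h2 : ((fun p : ℝ × ℝ => p.1 - p.2) ∘ fun w : ℂ => (w.re + w.im * x, w.re))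
          =O[𝓝[{w : ℂ | 0 < w.im}] (s₀ : ℂ)] (fun w => (w.im : ℂ)) := by
        refine Asymptotics.IsBigO.of_bound |x| (.of_forall fun w => ?_)
        simp [mul_comm]
      have h3 := (h1.trans_isBigO h2).tendsto_div_nhds_zero.add_const (x * v)
      rw [zero_add] at h3
      refine h3.congr' ?_
      filter_upwards [self_mem_nhdsWithin] with w hw
      have hw0 : (w.im : ℂ) ≠ 0 := by exact_mod_cast (show 0 < w.im from hw).ne'
      simp
      field_simp
      ring
    have hφx : Tendsto (fun w : ℂ => φ (w.re + w.im * x)) (𝓝[{w : ℂ | 0 < w.im}] (s₀ : ℂ))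
        (𝓝 (φ s₀)) := by
      have : ContinuousAt φ s₀ := hφ.continuousAt (Icc_mem_nhds
        (by linarith [ch.lt_left]) (by linarith [ch.lt_right]))
      exact this.tendsto.comp hcx
    have hx2 : (1 + x ^ 2 : ℂ) ≠ 0 := by
      exact_mod_cast (show (0 : ℝ) < 1 + x ^ 2 by positivity).ne'
    have hprod : (x * v - κ) * (x * v + κ) = v ^ 2 * (1 + x ^ 2) := by
      have hI : I ^ 2 = -1 := I_sq
      rw [hκ]
      linear_combination (-v ^ 2 * I ^ 2) * hς2 - v ^ 2 * hI
    have hlim : Tendsto (fun w : ℂ => φ (w.re + w.im * x) * (2 * κ) /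
        (((γ (w.re + w.im * x) - γ w.re) / w.im - κ) *
          ((γ (w.re + w.im * x) - γ w.re) / w.im + κ)))
        (𝓝[{w : ℂ | 0 < w.im}] (s₀ : ℂ))
        (𝓝 (φ s₀ * (2 * κ) / ((x * v - κ) * (x * v + κ)))) := by
      refine (hφx.mul_const _).div ((hq.sub_const _).mul (hq.add_const _)) ?_
      rw [hprod]
      exact mul_ne_zero (pow_ne_zero _ hv0) hx2
    have e : φ s₀ * (2 * κ) / ((x * v - κ) * (x * v + κ)) =
        (φ s₀ * (2 * κ) / v ^ 2) * (((1 + x ^ 2)⁻¹ : ℝ) : ℂ) := by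
      rw [hprod]
      push_cast
      field_simp
    rw [← e]
    refine hlim.congr' ?_
    filter_upwards [hev, hcx (Metric.ball_mem_nhds s₀ hδ)] with w ⟨hw, hw0⟩ hx
    have hw0 : 0 < w.im := hw0
    have hx : |w.re + w.im * x - s₀| < δ := by simpa [Real.dist_eq] using hx
    rw [indicator_of_mem ((hmemS _).2 hx)]
    have hs : 0 < √(1 + x ^ 2) := by positivity
    have hp : 0 < ‖v‖ / 2 * (w.im * √(1 + x ^ 2)) := by positivity
    have n1 := norm_pos_iff.1 (hp.trans_le (hlow w hw hw0 x hx))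
    have n2 := norm_pos_iff.1 (hp.trans_le (hlow' w hw hw0 x hx))
    have hwc : (w.im : ℂ) ≠ 0 := by exact_mod_cast hw0.ne'
    rw [jumpKernel_eq n1 n2]
    have e1 : γ (w.re + w.im * x) - tubeMap γ κ w =
        w.im * ((γ (w.re + w.im * x) - γ w.re) / w.im - κ) := by
      simp only [tubeMap]; field_simp; ring
    have e2 : γ (w.re + w.im * x) - tubeMap γ κ (starRingEnd ℂ w) =
        w.im * ((γ (w.re + w.im * x) - γ w.re) / w.im + κ) := by
      simp only [tubeMap, conj_re, conj_im, ofReal_neg]; field_simp; ring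
    rw [e1, e2]
    rw [e1] at n1
    rw [e2] at n2
    have n1' := right_ne_zero_of_mul n1
    have n2' := right_ne_zero_of_mul n2
    generalize (γ (w.re + w.im * x) - γ w.re) / w.im - κ = A at *
    generalize (γ (w.re + w.im * x) - γ w.re) / w.im + κ = B at *
    field_simp

/-- Plemelj's jump formula. -/
lemma tendsto_jump (ch : IsChart γ γ' s₀ δ ρ) (h : IsBoundaryCurve Ω γ γ') (hς : |ς| = 1)
    (hφ : ContinuousOn φ (Icc 0 (2 * π))) :
    Tendsto (fun w : ℂ => cauchyInt γ φ (tubeMap γ (ς * I * γ' s₀) w) -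
      cauchyInt γ φ (tubeMap γ (ς * I * γ' s₀) (starRingEnd ℂ w))) (𝓝[{w | 0 < w.im}] (s₀ : ℂ))
      (𝓝 (ς * (2 * π * I) * (φ s₀ / γ' s₀))) := by
  have := (ch.tendsto_local_jump h hς hφ).add (ch.tendsto_far_jump hς hφ)
  rw [add_zero] at this
  refine this.congr' ?_
  filter_upwards [ch.eventually_mem_rect.filter_mono nhdsWithin_le_nhds, self_mem_nhdsWithin]
    with w hw hw0
  have hw0 : 0 < w.im := hw0
  have c1 := h.continuousOn_kernel hφ (ch.tube_notMem_frontier h hς hw hw0.ne')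
  have c2 := h.continuousOn_kernel hφ (ch.tube_notMem_frontier h hς (conj_mem_rect hw)
    (by simpa using hw0.ne'))
  have hi : IntegrableOn (jumpKernel γ φ (ς * I * γ' s₀) w) (Ioc 0 (2 * π)) :=
    ((c1.sub c2).integrableOn_Icc).mono_set Ioc_subset_Icc_self
  have hsub : Ioo (s₀ - δ) (s₀ + δ) ⊆ Ioc 0 (2 * π) := fun t ht =>
    ⟨by linarith [ht.1, ch.lt_left], by linarith [ht.2, ch.lt_right]⟩
  rw [cauchyInt, cauchyInt, ← intervalIntegral.integral_sub
    (intervalIntegrable_of_continuousOn c1) (intervalIntegrable_of_continuousOn c2),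
    intervalIntegral.integral_of_le two_pi_nonneg]
  rw [add_comm, setIntegral_sdiff measurableSet_Ioo hi hsub, sub_add_cancel]
  rfl

end IsChart

end IsBoundaryCurve

namespace IsBoundaryCurve

variable {Ω : Set ℂ} {γ γ' φ : ℝ → ℂ}

lemma exists_extreme_point (h : IsBoundaryCurve Ω γ γ') :
    ∃ c : ℝ, |c| = 1 ∧ ∃ s ∈ Ioo 0 (2 * π), ∀ t ∈ Icc 0 (2 * π),
      c * (γ t).re ≤ c * (γ s).re := by
  have hc : ContinuousOn (fun t => (γ t).re) (Icc 0 (2 * π)) :=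
    (Complex.continuous_re.comp h.continuous).continuousOn
  have hne : (Icc 0 (2 * π)).Nonempty := ⟨0, le_rfl, two_pi_nonneg⟩
  obtain ⟨a, ha, hmax⟩ := isCompact_Icc.exists_isMaxOn hne hc
  obtain ⟨b, hb, hmin⟩ := isCompact_Icc.exists_isMinOn hne hc
  have hend : ∀ x ∈ Icc 0 (2 * π), x ∉ Ioo 0 (2 * π) → γ x = γ 0 := by
    intro x hx hx'
    rcases eq_or_lt_of_le hx.1 with h0 | h0
    · rw [← h0]
    · rcases eq_or_lt_of_le hx.2 with h1 | h1
      · rw [h1, h.closed]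
      · exact absurd ⟨h0, h1⟩ hx'
  by_cases ha' : a ∈ Ioo 0 (2 * π)
  · exact ⟨1, by simp, a, ha', fun t ht => by simpa using hmax ht⟩
  by_cases hb' : b ∈ Ioo 0 (2 * π)
  · exact ⟨-1, by simp, b, hb', fun t ht => by simpa using hmin ht⟩
  have hπ : π ∈ Ioo 0 (2 * π) := ⟨pi_pos, by linarith [pi_pos]⟩
  refine ⟨1, by simp, π, hπ, fun t ht => ?_⟩
  have h1 : (γ t).re ≤ (γ a).re := hmax ht
  have h2 : (γ b).re ≤ (γ π).re := hmin (Ioo_subset_Icc_self hπ)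
  rw [hend a ha ha'] at h1
  rw [hend b hb hb'] at h2
  linarith

lemma neg_side {s₀ ς : ℝ} (w : ℂ) :
    tubeMap γ (((-ς : ℝ) : ℂ) * I * γ' s₀) (starRingEnd ℂ w) = tubeMap γ (ς * I * γ' s₀) w := by
  simp [tubeMap]

lemma disjoint_frontier (h : IsBoundaryCurve Ω γ γ') : Ω ⊆ (frontier Ω)ᶜ := fun x hx hf =>
  (h.isOpen.inter_frontier_eq ▸ ⟨hx, hf⟩ : x ∈ (∅ : Set ℂ))

/-- `U` lies on the other side of the curve than `Ω`; `ς` is the orientation of `γ` with respect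
to `Ω`. -/
structure IsOuterSide (Ω : Set ℂ) (γ γ' : ℝ → ℂ) (ς : ℝ) (U : Set ℂ) : Prop where
  abs_eq_one : |ς| = 1
  isPreconnected : IsPreconnected U
  subset_compl : U ⊆ (frontier Ω)ᶜ
  isSaturated : IsSaturated Ω U
  disjoint : Disjoint U Ω
  not_isBounded : ¬ Bornology.IsBounded U
  sideIn_self : ∀ s ∈ Ioo 0 (2 * π), SideIn γ γ' Ω ς s
  sideIn_outer : ∀ s ∈ Ioo 0 (2 * π), SideIn γ γ' U (-ς) s

lemma exists_isOuterSide (h : IsBoundaryCurve Ω γ γ') : ∃ ς U, IsOuterSide Ω γ γ' ς U := by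
  obtain ⟨c, hc, s, hs, hmax⟩ := h.exists_extreme_point
  have hc2 : c * c = 1 := by rw [← abs_mul_abs_self, hc, one_mul]
  have hH : {z : ℂ | c * (γ s).re < c * z.re} ⊆ (frontier Ω)ᶜ := by
    intro z hz hf
    rw [← h.image_eq] at hf
    obtain ⟨t, ht, rfl⟩ := hf
    exact absurd (hmax t ht) (not_le.2 hz)
  have hHc : IsPreconnected {z : ℂ | c * (γ s).re < c * z.re} := by
    have : Convex ℝ {z : ℂ | c * (γ s).re < (c • reCLM : ℂ →L[ℝ] ℝ) z} :=
      convex_halfSpace_gt (c • reCLM : ℂ →L[ℝ] ℝ).toLinearMap.isLinear _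
    exact this.isPreconnected
  have hmem : ∀ x : ℝ, 0 < x → γ s + (x * c : ℝ) ∈ {z : ℂ | c * (γ s).re < c * z.re} := by
    intro x hx
    simp only [mem_ofPred_eq, add_re, ofReal_re]
    nlinarith
  set U := connectedComponentIn (frontier Ω)ᶜ (γ s + (1 * c : ℝ)) with hU
  have hHU : {z : ℂ | c * (γ s).re < c * z.re} ⊆ U :=
    hHc.subset_connectedComponentIn (hmem 1 one_pos) hH
  have hUb : ¬ Bornology.IsBounded U := by
    intro hb
    obtain ⟨R, hR⟩ := (hb.subset hHU).exists_norm_le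
    have h1 := hR _ (hmem (|R| + ‖γ s‖ + 1) (by positivity))
    have h2 := norm_sub_le_norm_add (((|R| + ‖γ s‖ + 1) * c : ℝ) : ℂ) (γ s)
    rw [Complex.norm_real, Real.norm_eq_abs, abs_mul, hc, mul_one, abs_of_nonneg (by positivity),
      add_comm _ (γ s)] at h2
    linarith [le_abs_self R]
  have hUf : U ⊆ (frontier Ω)ᶜ := connectedComponentIn_subset _ _
  have hUd : Disjoint U Ω := by
    rw [Set.disjoint_iff_inter_eq_empty, ← Set.not_nonempty_iff_eq_empty]
    intro hne
    exact hUb (h.isBounded.subset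
      (h.isSaturated_self U isPreconnected_connectedComponentIn hUf hne))
  have hsat : IsSaturated Ω U := isSaturated_connectedComponentIn _
  -- the tangent at the extreme point is vertical
  have hre : (γ' s).re = 0 := by
    have hd : HasDerivAt (fun t => c * (γ t).re) (c * (γ' s).re) s :=
      (reCLM.hasFDerivAt.comp_hasDerivAt s (h.hasDerivAt s)).const_mul c
    have hl : IsLocalMax (fun t => c * (γ t).re) s := by
      filter_upwards [Icc_mem_nhds hs.1 hs.2] with t ht using hmax t ht
    have := hl.hasDerivAt_eq_zero hd
    rcases mul_eq_zero.1 this with h0 | h0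
    · simp [h0] at hc
    · exact h0
  have him : (γ' s).im ≠ 0 := fun h0 => h.deriv_ne_zero s (Complex.ext hre h0)
  obtain ⟨ς, hς, hpos⟩ : ∃ ς : ℝ, |ς| = 1 ∧ 0 < c * (ς * (γ' s).im) := by
    rcases lt_or_gt_of_ne (mul_ne_zero (fun h0 => by simp [h0] at hc : c ≠ 0) him) with h1 | h1
    · exact ⟨-1, by simp, by linarith⟩
    · exact ⟨1, by simp, by linarith⟩
  have hside : SideIn γ γ' U (-ς) s := by
    refine eventually_nhdsWithin_of_forall fun τ hτ => hHU ?_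
    have hτ : 0 < τ := hτ
    simp only [mem_ofPred_eq, add_re, mul_re, ofReal_re, ofReal_im, I_re, I_im, hre, mul_im,
      neg_mul]
    nlinarith
  have hς' : |(-ς)| = 1 := by rwa [abs_neg]
  refine ⟨ς, U, hς, isPreconnected_connectedComponentIn, hUf, hsat, hUd, hUb, fun t ht => ?_,
    fun t ht => h.sideIn_of_sideIn hς' hsat hs ht hside⟩
  refine h.sideIn_of_sideIn hς h.isSaturated_self hs ht ?_
  obtain ⟨δ, ρ, ch⟩ := h.exists_isChart hs
  have h00 : |s - s| < ρ := by simpa using ch.rho_pos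
  have hcl : γ s ∈ closure Ω :=
    frontier_subset_closure (h.mem_frontier (Ioo_subset_Icc_self hs))
  obtain ⟨_, ⟨w, hw, rfl⟩, hwΩ⟩ := mem_closure_iff_nhds.1 hcl _
    (ch.image_rect_mem_nhds h hς ch.rho_le h00)
  have hw0 : w.im ≠ 0 := fun h0 =>
    h.disjoint_frontier hwΩ ((ch.mem_frontier_iff h hς hw).2 h0)
  rcases lt_or_gt_of_ne hw0 with h1 | h1
  · exfalso
    have h2 := (ch.sideIn_iff h hς' hsat h00).1 hside
    refine Set.disjoint_left.1 hUd (h2 ⟨starRingEnd ℂ w, ⟨?_, ?_, ?_⟩, neg_side w⟩) hwΩ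
    · simpa using hw.1
    · simpa using h1
    · simpa using (by linarith [(abs_lt.1 hw.2).1] : -w.im < ρ)
  · rw [ch.sideIn_iff h hς h.isSaturated_self h00]
    exact h.isSaturated_self _ (ch.isPreconnected_image_upperRect h _)
      (ch.image_upperRect_subset_compl h hς)
      ⟨_, ⟨w, ⟨hw.1, h1, (abs_lt.1 hw.2).2⟩, rfl⟩, hwΩ⟩

namespace IsOuterSide

variable {ς : ℝ} {U : Set ℂ}

lemma image_upperRect_subset (o : IsOuterSide Ω γ γ' ς U) (h : IsBoundaryCurve Ω γ γ')
    {s₀ δ ρ : ℝ} (ch : IsChart γ γ' s₀ δ ρ) {w : ℂ} (hw : w ∈ rect s₀ ρ) (h0 : 0 < w.im) :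
    tubeMap γ (ς * I * γ' s₀) w ∈ Ω := by
  have h00 : |s₀ - s₀| < ρ := by simpa using ch.rho_pos
  have hs : s₀ ∈ Ioo 0 (2 * π) := ch.mem_Ioo (by simpa using ch.rho_pos.trans_le ch.rho_le)
  exact (ch.sideIn_iff h o.abs_eq_one h.isSaturated_self h00).1 (o.sideIn_self s₀ hs)
    ⟨w, ⟨hw.1, h0, (abs_lt.1 hw.2).2⟩, rfl⟩

lemma image_lowerRect_subset (o : IsOuterSide Ω γ γ' ς U) (h : IsBoundaryCurve Ω γ γ')
    {s₀ δ ρ : ℝ} (ch : IsChart γ γ' s₀ δ ρ) {w : ℂ} (hw : w ∈ rect s₀ ρ) (h0 : w.im < 0) :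
    tubeMap γ (ς * I * γ' s₀) w ∈ U := by
  have h00 : |s₀ - s₀| < ρ := by simpa using ch.rho_pos
  have hs : s₀ ∈ Ioo 0 (2 * π) := ch.mem_Ioo (by simpa using ch.rho_pos.trans_le ch.rho_le)
  refine (ch.sideIn_iff h (by rw [abs_neg]; exact o.abs_eq_one) o.isSaturated h00).1
    (o.sideIn_outer s₀ hs) ⟨starRingEnd ℂ w, ⟨?_, ?_, ?_⟩, neg_side w⟩
  · simpa using hw.1
  · simpa using h0
  · simpa using (by linarith [(abs_lt.1 hw.2).1] : -w.im < ρ)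

lemma mem_iff (o : IsOuterSide Ω γ γ' ς U) (h : IsBoundaryCurve Ω γ γ')
    {s₀ δ ρ : ℝ} (ch : IsChart γ γ' s₀ δ ρ) {w : ℂ} (hw : w ∈ rect s₀ ρ) :
    tubeMap γ (ς * I * γ' s₀) w ∈ Ω ↔ 0 < w.im := by
  refine ⟨fun hm => ?_, o.image_upperRect_subset h ch hw⟩
  rcases lt_trichotomy w.im 0 with h0 | h0 | h0
  · exact absurd hm (Set.disjoint_left.1 o.disjoint (o.image_lowerRect_subset h ch hw h0))
  · exact absurd ((ch.mem_frontier_iff h o.abs_eq_one hw).2 h0) (h.disjoint_frontier hm)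
  · exact h0

lemma cauchyInt_eq_zero (o : IsOuterSide Ω γ γ' ς U) (h : IsBoundaryCurve Ω γ γ')
    (hφ : ContinuousOn φ (Icc 0 (2 * π)))
    (hm : ∀ m : ℕ, ∫ t in (0 : ℝ)..(2 * π), γ t ^ m * φ t = 0) {z : ℂ} (hz : z ∈ U) :
    cauchyInt γ φ z = 0 := by
  obtain ⟨R, -, hR⟩ := h.cauchyInt_eq_zero_of_large hφ hm
  obtain ⟨z₀, hz₀, hlt⟩ : ∃ z₀ ∈ U, R < ‖z₀‖ := by
    by_contra! hcon
    exact o.not_isBounded (isBounded_iff_forall_norm_le.2 ⟨R, hcon⟩)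
  refine h.eqOn_zero_of_mem hφ o.isPreconnected o.subset_compl hz₀ ?_ z hz
  filter_upwards [(isOpen_lt continuous_const continuous_norm).mem_nhds hlt] with y hy using hR y hy

end IsOuterSide

end IsBoundaryCurve

/-- Maximum principle with boundary values understood as upper limits. -/
lemma norm_le_of_eventually_norm_le {W : Set ℂ} (hW : IsOpen W) (hWb : Bornology.IsBounded W)
    {H : ℂ → ℂ} (hH : DifferentiableOn ℂ H W) {C : ℝ}
    (hC : ∀ q ∈ frontier W, ∀ ε > 0, ∀ᶠ z in 𝓝[W] q, ‖H z‖ ≤ C + ε) {z : ℂ} (hz : z ∈ W) :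
    ‖H z‖ ≤ C := by
  refine le_of_forall_pos_le_add fun ε hε => ?_
  by_contra! hlt
  obtain ⟨c, hc⟩ : ∃ c, c = C + ε := ⟨_, rfl⟩
  rw [← hc] at hlt
  have hcont : ContinuousOn (fun z => ‖H z‖) W := hH.continuousOn.norm
  obtain ⟨V, hV⟩ : ∃ V, V = W ∩ (fun z => ‖H z‖) ⁻¹' Ioi c := ⟨_, rfl⟩
  have hVo : IsOpen V := hV ▸ hcont.isOpen_inter_preimage hW isOpen_Ioi
  have hVW : V ⊆ W := hV ▸ inter_subset_left
  have hcl : closure V ⊆ W := by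
    intro q hq
    by_contra hqW
    have hqf : q ∈ frontier W := by
      rw [hW.frontier_eq]
      exact ⟨closure_mono hVW hq, hqW⟩
    have h1 := hC q hqf ε hε
    rw [eventually_nhdsWithin_iff] at h1
    obtain ⟨y, hy, hyV⟩ := (mem_closure_iff_frequently.1 hq).and_eventually h1 |>.exists
    rw [hV] at hy
    have := hyV hy.1
    have h2 : c < ‖H y‖ := hy.2
    linarith
  have hfr : ∀ q ∈ frontier V, ‖H q‖ ≤ c := by
    intro q hq
    by_contra! h1
    have hqV : q ∈ V := by
      rw [hV]
      exact ⟨hcl (frontier_subset_closure hq), h1⟩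
    rw [hVo.frontier_eq] at hq
    exact hq.2 hqV
  have hzV : z ∈ V := hV ▸ ⟨hz, hlt⟩
  have := Complex.norm_le_of_forall_mem_frontier_norm_le (hWb.subset hVW)
    (⟨hH.mono hVW, hH.continuousOn.mono hcl⟩ : DiffContOnCl ℂ H V) hfr (subset_closure hzV)
  linarith

namespace IsBoundaryCurve
variable {Ω U : Set ℂ} {γ γ' φ : ℝ → ℂ} {ς : ℝ}

lemma tendsto_cauchyInt (h : IsBoundaryCurve Ω γ γ') (o : IsOuterSide Ω γ γ' ς U)
    (hφ : ContinuousOn φ (Icc 0 (2 * π)))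
    (hm : ∀ m : ℕ, ∫ t in (0 : ℝ)..(2 * π), γ t ^ m * φ t = 0) {s₀ : ℝ}
    (hs₀ : s₀ ∈ Ioo 0 (2 * π)) :
    Tendsto (cauchyInt γ φ) (𝓝[Ω] (γ s₀)) (𝓝 (ς * (2 * π * I) * (φ s₀ / γ' s₀))) := by
  obtain ⟨δ, ρ, ch⟩ := h.exists_isChart hs₀
  have ht := ch.tendsto_jump h o.abs_eq_one hφ
  rw [tendsto_iff_eventually] at ht ⊢
  intro P hP
  have h1 := ht hP
  rw [eventually_nhdsWithin_iff] at h1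
  obtain ⟨S, hS, hSo, hsS⟩ := eventually_nhds_iff.1 (h1.and ch.eventually_mem_rect)
  have him := ch.isOpen_image h o.abs_eq_one hSo fun w hw => ch.rect_subset (hS w hw).2
  have hmem : γ s₀ ∈ tubeMap γ (ς * I * γ' s₀) '' S := ⟨s₀, hsS, by simp [tubeMap]⟩
  rw [eventually_nhdsWithin_iff]
  filter_upwards [him.mem_nhds hmem]
  rintro _ ⟨w, hw, rfl⟩ hΩ
  obtain ⟨hwP, hwr⟩ := hS w hw
  have hpos := (o.mem_iff h ch hwr).1 hΩ
  have h2 := hwP hpos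
  rw [o.cauchyInt_eq_zero h hφ hm (o.image_lowerRect_subset h ch (conj_mem_rect hwr)
    (by simpa using hpos)), sub_zero] at h2
  exact h2

lemma norm_cauchyInt_le (γ : ℝ → ℂ) (hφ : ContinuousOn φ (Icc 0 (2 * π))) :
    ∃ C > 0, ∀ z, ∀ d > 0, (∀ t ∈ Icc 0 (2 * π), d ≤ ‖γ t - z‖) →
      ‖cauchyInt γ φ z‖ ≤ C / d := by
  obtain ⟨M, hM⟩ := isCompact_Icc.exists_bound_of_continuousOn hφ
  refine ⟨(|M| + 1) * (2 * π), by positivity, fun z d hd hz => ?_⟩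
  have := intervalIntegral.norm_integral_le_of_norm_le_const (a := 0) (b := 2 * π)
    (f := fun t => φ t / (γ t - z)) (C := (|M| + 1) / d) fun t ht => by
      rw [uIoc_of_le two_pi_nonneg] at ht
      have ht' : t ∈ Icc 0 (2 * π) := Ioc_subset_Icc_self ht
      rw [norm_div]
      have h1 := hM t ht'
      have h2 := hz t ht'
      have h3 := le_abs_self M
      gcongr
      linarith
  rw [sub_zero, abs_of_nonneg two_pi_nonneg] at this
  rw [cauchyInt]
  exact this.trans_eq (by ring)

end IsBoundaryCurve

/-- Along the arc `g` on `[0, T]` the distance to the starting point `p` controls the position. -/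
structure IsRadial (g : ℝ → ℂ) (p : ℂ) (T : ℝ) : Prop where
  continuous : Continuous g
  apply_zero : g 0 = p
  norm_sub_le : ∀ s ∈ Icc 0 T, ∀ t ∈ Icc 0 T, ‖g t - g s‖ ≤ 5 * |‖g t - p‖ - ‖g s - p‖|

lemma isRadial_of_norm_sub_sub_le {g : ℝ → ℂ} {v : ℂ} {T : ℝ} (hg : Continuous g)
    (hv : ∀ s ∈ Icc 0 T, ∀ t ∈ Icc 0 T, ‖g t - g s - (t - s : ℝ) * v‖ ≤ ‖v‖ / 4 * |t - s|) :
    IsRadial g (g 0) T := by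
  have key : ∀ s ∈ Icc 0 T, ∀ t ∈ Icc 0 T, s ≤ t →
      ‖g t - g s‖ ≤ 5 * (‖g t - g 0‖ - ‖g s - g 0‖) := by
    intro s hs t ht hst
    have h1 := hv s hs t ht
    have h0 := hv 0 ⟨le_rfl, hs.1.trans hs.2⟩ s hs
    rw [abs_of_nonneg (by linarith)] at h1
    rw [abs_of_nonneg (by linarith [hs.1]), sub_zero] at h0
    have h2 : ‖g t - g s‖ ≤ 5 / 4 * ‖v‖ * (t - s) := by
      have := norm_add_le (g t - g s - (t - s : ℝ) * v) ((t - s : ℝ) * v)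
      rw [sub_add_cancel, norm_mul, norm_real, Real.norm_of_nonneg (by linarith)] at this
      linarith
    have h3 : ‖v‖ / 4 * (t - s) ≤ ‖g t - g 0‖ - ‖g s - g 0‖ := by
      rcases hs.1.eq_or_lt with rfl | hs0
      · have := norm_sub_norm_le ((t - 0 : ℝ) * v) (((t - 0 : ℝ) * v) - (g t - g 0))
        rw [sub_sub_cancel, norm_mul, norm_real, Real.norm_of_nonneg (by linarith),
          norm_sub_rev] at this
        simp only [sub_self, norm_zero]
        nlinarith [norm_nonneg v]
      · have e : (s : ℂ) * (g t - g 0) = t * (g s - g 0) +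
            (s * (g t - g s - (t - s : ℝ) * v) - (t - s : ℝ) * (g s - g 0 - (s : ℝ) * v)) := by
          push_cast
          ring
        have h4 : t * ‖g s - g 0‖ ≤ s * ‖g t - g 0‖ +
            (s * (‖v‖ / 4 * (t - s)) + (t - s) * (‖v‖ / 4 * s)) := by
          have e1 : (t : ℂ) * (g s - g 0) = (s : ℂ) * (g t - g 0) -
            (s * (g t - g s - (t - s : ℝ) * v) - (t - s : ℝ) * (g s - g 0 - (s : ℝ) * v)) := by
            rw [e]
            ring
          have e2 := congrArg norm e1
          rw [norm_mul, norm_real, Real.norm_of_nonneg (by linarith)] at e2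
          rw [e2]
          refine (norm_sub_le _ _).trans (add_le_add ?_ ((norm_sub_le _ _).trans
            (add_le_add ?_ ?_)))
          · rw [norm_mul, norm_real, Real.norm_of_nonneg (by linarith)]
          · rw [norm_mul, norm_real, Real.norm_of_nonneg (by linarith)]
            gcongr
          · rw [norm_mul, norm_real, Real.norm_of_nonneg (by linarith)]
            have : 0 ≤ t - s := by linarith
            gcongr
        have h5 : 3 / 4 * ‖v‖ * s ≤ ‖g s - g 0‖ := by
          have := norm_sub_norm_le ((s : ℝ) * v) (((s : ℝ) * v) - (g s - g 0))
          rw [sub_sub_cancel, norm_mul, norm_real, Real.norm_of_nonneg (by linarith),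
            norm_sub_rev] at this
          linarith
        have h6 : (t - s) * (3 / 4 * ‖v‖ * s) ≤ (t - s) * ‖g s - g 0‖ :=
          mul_le_mul_of_nonneg_left h5 (by linarith)
        refine le_of_mul_le_mul_left ?_ hs0
        nlinarith
    linarith
  refine ⟨hg, rfl, fun s hs t ht => ?_⟩
  rcases le_total s t with hst | hst
  · exact (key s hs t ht hst).trans (by gcongr; exact le_abs_self _)
  · rw [norm_sub_rev, abs_sub_comm]
    exact (key t ht s hs hst).trans (by gcongr; exact le_abs_self _)

lemma IsRadial.exists_norm_eq {g : ℝ → ℂ} {p : ℂ} {T ρ : ℝ} (hg : IsRadial g p T) (hT : 0 ≤ T)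
    (hρ : 0 ≤ ρ) (hρT : ρ ≤ ‖g T - p‖) : ∃ τ ∈ Icc 0 T, ‖g τ - p‖ = ρ ∧
      ∀ z, ‖z - p‖ = ρ → ∀ t ∈ Icc 0 T, ‖z - g τ‖ ≤ 6 * ‖g t - z‖ := by
  obtain ⟨τ, hτ, e⟩ := intermediate_value_Icc hT
    ((hg.continuous.sub continuous_const).norm.continuousOn (s := Icc 0 T))
    (show ρ ∈ Icc ‖g 0 - p‖ ‖g T - p‖ from ⟨by rw [hg.apply_zero]; simpa using hρ, hρT⟩)
  refine ⟨τ, hτ, e, fun z hz t ht => ?_⟩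
  have h1 := hg.norm_sub_le τ hτ t ht
  have e' : ‖g τ - p‖ = ρ := e
  rw [e', ← hz] at h1
  have h2 := abs_norm_sub_norm_le (g t - p) (z - p)
  rw [sub_sub_sub_cancel_right] at h2
  have h3 := norm_sub_le_norm_sub_add_norm_sub z (g t) (g τ)
  rw [norm_sub_rev z (g t)] at h3
  linarith

namespace IsBoundaryCurve
variable {Ω U : Set ℂ} {γ γ' φ : ℝ → ℂ} {ς : ℝ}

lemma exists_isRadial (h : IsBoundaryCurve Ω γ γ') : ∃ T > 0, T < π ∧ IsRadial γ (γ 0) T ∧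
    IsRadial (fun s => γ (2 * π - s)) (γ 0) T ∧
    ∃ r > 0, ∀ t ∈ Icc T (2 * π - T), r ≤ ‖γ t - γ 0‖ := by
  obtain ⟨δ, hδ, hd⟩ := h.exists_uniform_deriv_close
  obtain ⟨T, hT⟩ : ∃ T, T = min (δ / 2) (π / 2) := ⟨_, rfl⟩
  have hT0 : 0 < T := hT ▸ lt_min (by positivity) (by positivity)
  have hTδ : T < δ := by
    have := min_le_left (δ / 2) (π / 2)
    rw [← hT] at this
    linarith
  have hTπ : T < π := by
    have := min_le_right (δ / 2) (π / 2)
    rw [← hT] at this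
    linarith [pi_pos]
  refine ⟨T, hT0, hTπ, ?_, ?_, ?_⟩
  · refine isRadial_of_norm_sub_sub_le (v := γ' 0) h.continuous fun s hs t ht => ?_
    refine h.norm_sub_sub_le (hd 0 ⟨le_rfl, two_pi_nonneg⟩) ?_ ?_
    · rw [sub_zero, abs_of_nonneg ht.1]
      linarith [ht.2]
    · rw [sub_zero, abs_of_nonneg hs.1]
      linarith [hs.2]
  · have e : γ 0 = (fun s => γ (2 * π - s)) 0 := by simp [h.closed]
    rw [e]
    refine isRadial_of_norm_sub_sub_le (v := -γ' (2 * π))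
      (h.continuous.comp (continuous_const.sub continuous_id)) fun s hs t ht => ?_
    have := h.norm_sub_sub_le (hd (2 * π) ⟨two_pi_nonneg, le_rfl⟩) (s := 2 * π - t)
      (t := 2 * π - s) (by
        rw [sub_sub_cancel_left, abs_neg, abs_of_nonneg ht.1]
        linarith [ht.2]) (by
        rw [sub_sub_cancel_left, abs_neg, abs_of_nonneg hs.1]
        linarith [hs.2])
    rw [sub_sub_sub_cancel_left, abs_sub_comm] at this
    rw [norm_neg]
    refine le_of_eq_of_le (congrArg norm ?_) this
    push_cast
    ring
  · have hne : (Icc T (2 * π - T)).Nonempty := nonempty_Icc.2 (by linarith)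
    obtain ⟨t, ht, hmin⟩ := isCompact_Icc.exists_isMinOn hne
      ((h.continuous.sub continuous_const).norm.continuousOn (s := Icc T (2 * π - T))
        (f := fun t => ‖γ t - γ 0‖))
    refine ⟨‖γ t - γ 0‖, ?_, fun s hs => hmin hs⟩
    rw [gt_iff_lt, norm_pos_iff, sub_ne_zero]
    intro e
    have := h.eq_of_apply_eq (s := t) (t := 0) ⟨by linarith [ht.1], by linarith [ht.2]⟩
      ⟨le_rfl, two_pi_nonneg⟩ e.symm
    linarith [ht.1]

/-- A small circle around `γ 0` meets the curve only in two points, and these control the distance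
to the curve on the circle. -/
lemma exists_crosscut (h : IsBoundaryCurve Ω γ γ') : ∃ r > 0, ∀ ρ ∈ Ioo 0 r,
    ∃ q₁ ∈ frontier Ω, ∃ q₂ ∈ frontier Ω, ‖q₁ - γ 0‖ = ρ ∧ ‖q₂ - γ 0‖ = ρ ∧
      ∀ z, ‖z - γ 0‖ = ρ → ∀ t ∈ Icc 0 (2 * π),
        min ‖z - q₁‖ ‖z - q₂‖ ≤ 6 * ‖γ t - z‖ := by
  obtain ⟨T, hT0, hTπ, h1, h2, r, hr, hfar⟩ := h.exists_isRadial
  refine ⟨r / 2, by positivity, fun ρ hρ => ?_⟩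
  obtain ⟨τ₁, hτ₁, e₁, hz₁⟩ := h1.exists_norm_eq hT0.le hρ.1.le (by
    have := hfar T ⟨le_rfl, by linarith⟩
    linarith [hρ.2])
  obtain ⟨τ₂, hτ₂, e₂, hz₂⟩ := h2.exists_norm_eq hT0.le hρ.1.le (by
    have := hfar (2 * π - T) ⟨by linarith, by linarith⟩
    linarith [hρ.2])
  refine ⟨γ τ₁, h.mem_frontier ⟨hτ₁.1, by linarith [hτ₁.2]⟩, γ (2 * π - τ₂),
    h.mem_frontier ⟨by linarith [hτ₂.2], by linarith [hτ₂.1]⟩, e₁, e₂, fun z hz t ht => ?_⟩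
  by_cases ht1 : t ≤ T
  · exact (min_le_left _ _).trans (hz₁ z hz t ⟨ht.1, ht1⟩)
  by_cases ht2 : 2 * π - T ≤ t
  · have := hz₂ z hz (2 * π - t) ⟨by linarith [ht.2], by linarith⟩
    rw [sub_sub_cancel] at this
    exact (min_le_right _ _).trans this
  · have h3 := hfar t ⟨by linarith, by linarith⟩
    have h4 := norm_sub_le_norm_sub_add_norm_sub (γ t) z (γ 0)
    have h5 := norm_sub_le_norm_sub_add_norm_sub z (γ 0) (γ τ₁)
    rw [norm_sub_rev (γ 0)] at h5
    refine (min_le_left _ _).trans ?_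
    linarith [hρ.2]

lemma exists_eq_of_mem_frontier (h : IsBoundaryCurve Ω γ γ') {q : ℂ} (hq : q ∈ frontier Ω)
    (hq0 : q ≠ γ 0) : ∃ s ∈ Ioo 0 (2 * π), γ s = q := by
  obtain ⟨s, hs, rfl⟩ := h.image_eq ▸ hq
  refine ⟨s, ⟨lt_of_le_of_ne hs.1 ?_, lt_of_le_of_ne hs.2 ?_⟩, rfl⟩
  · rintro rfl
    exact hq0 rfl
  · rintro rfl
    exact hq0 h.closed.symm

lemma exists_norm_cauchyInt_mul_sq_le (h : IsBoundaryCurve Ω γ γ') (o : IsOuterSide Ω γ γ' ς U)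
    (hφ : ContinuousOn φ (Icc 0 (2 * π)))
    (hm : ∀ m : ℕ, ∫ t in (0 : ℝ)..(2 * π), γ t ^ m * φ t = 0) :
    ∃ C, ∀ z ∈ Ω, ‖cauchyInt γ φ z‖ * ‖z - γ 0‖ ^ 2 ≤ C := by
  obtain ⟨C, hC0, hC⟩ := norm_cauchyInt_le γ hφ
  obtain ⟨r, hr, hcross⟩ := h.exists_crosscut
  obtain ⟨M, hM⟩ := isCompact_Icc.exists_bound_of_continuousOn (f := fun s => φ s / γ' s)
    (hφ.div h.continuous_deriv.continuousOn fun t _ => h.deriv_ne_zero t)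
  obtain ⟨R, hR0, hR⟩ : ∃ R > 0, ∀ z ∈ closure Ω, ‖z‖ ≤ R := by
    obtain ⟨R, hR⟩ := isBounded_iff_forall_norm_le.1 h.isBounded.closure
    exact ⟨|R| + 1, by positivity, fun z hz => (hR z hz).trans (by linarith [le_abs_self R])⟩
  have hR2 : ∀ z ∈ closure Ω, ∀ w ∈ closure Ω, ‖z - w‖ ≤ 2 * R := fun z hz w hw =>
    (norm_sub_le _ _).trans (by linarith [hR z hz, hR w hw])
  obtain ⟨C', hC'⟩ : ∃ C', C' = max (6 * C * (2 * r)) (2 * π * |M| * (2 * R) * (2 * R)) :=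
    ⟨_, rfl⟩
  have step : ∀ ρ ∈ Ioo 0 r, ∀ z ∈ Ω, ρ < ‖z - γ 0‖ →
      ‖cauchyInt γ φ z‖ * (‖z - γ 0‖ - ρ) ^ 2 ≤ C' := by
    intro ρ hρ z hz hzρ
    obtain ⟨q₁, hq₁, q₂, hq₂, e₁, e₂, hq⟩ := hcross ρ hρ
    obtain ⟨W, hW⟩ : ∃ W, W = Ω ∩ {z | ρ < ‖z - γ 0‖} := ⟨_, rfl⟩
    have hcn : Continuous fun z : ℂ => ‖z - γ 0‖ := by fun_prop
    have hWo : IsOpen W := hW ▸ h.isOpen.inter (isOpen_lt continuous_const hcn)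
    have hWΩ : W ⊆ Ω := hW ▸ inter_subset_left
    have hd : DifferentiableOn ℂ (fun z => cauchyInt γ φ z * ((z - q₁) * (z - q₂))) Ω :=
      ((h.differentiableOn_cauchyInt hφ).mono h.disjoint_frontier).mul
        (by fun_prop)
    have hmain := norm_le_of_eventually_norm_le hWo (h.isBounded.subset hWΩ) (hd.mono hWΩ)
      (C := C') (fun q hqW ε hε => ?_) (hW ▸ ⟨hz, hzρ⟩ : z ∈ W)
    · refine le_trans ?_ hmain
      rw [norm_mul, norm_mul, sq]
      have h1 := norm_sub_le_norm_sub_add_norm_sub z q₁ (γ 0)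
      have h2 := norm_sub_le_norm_sub_add_norm_sub z q₂ (γ 0)
      have h3 : 0 ≤ ‖z - γ 0‖ - ρ := by linarith
      gcongr
      · linarith
      · linarith
    · have hqcl : q ∈ closure Ω := closure_mono hWΩ (frontier_subset_closure hqW)
      have hqρ : ρ ≤ ‖q - γ 0‖ := by
        have : closure W ⊆ {z | ρ ≤ ‖z - γ 0‖} := closure_minimal
          (hW ▸ fun z hz => (le_of_lt hz.2 : ρ ≤ ‖z - γ 0‖)) (isClosed_le continuous_const hcn)
        exact this (frontier_subset_closure hqW)
      suffices ∃ L, ‖L‖ ≤ C' ∧ Tendsto (fun z => cauchyInt γ φ z * ((z - q₁) * (z - q₂)))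
          (𝓝[Ω] q) (𝓝 L) by
        obtain ⟨L, hL, ht⟩ := this
        have := (ht.norm.eventually_lt_const (show ‖L‖ < C' + ε by linarith)).filter_mono
          (nhdsWithin_mono q hWΩ)
        exact this.mono fun _ h => h.le
      by_cases hqΩ : q ∈ Ω
      · refine ⟨_, ?_, (hd.continuousOn q hqΩ)⟩
        have hqe : ‖q - γ 0‖ = ρ := by
          refine le_antisymm ?_ hqρ
          by_contra! hlt
          rw [hWo.frontier_eq] at hqW
          exact hqW.2 (hW ▸ ⟨hqΩ, hlt⟩)
        have hne : ∀ q' ∈ frontier Ω, 0 < ‖q - q'‖ := fun q' hq' => by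
          rw [norm_pos_iff, sub_ne_zero]
          rintro rfl
          exact h.disjoint_frontier hqΩ hq'
        have hle : ∀ q', ‖q' - γ 0‖ = ρ → ‖q - q'‖ ≤ 2 * r := fun q' hq' => by
          have := norm_sub_le_norm_sub_add_norm_sub q (γ 0) q'
          rw [norm_sub_rev (γ 0)] at this
          linarith [hρ.2]
        obtain ⟨d, hd'⟩ : ∃ d, d = min ‖q - q₁‖ ‖q - q₂‖ := ⟨_, rfl⟩
        have hd0 : 0 < d := hd' ▸ lt_min (hne _ hq₁) (hne _ hq₂)
        have h1 := hC q (d / 6) (by positivity) fun t ht => by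
          have := hq q hqe t ht
          rw [← hd'] at this
          linarith
        have hmul : ‖q - q₁‖ * ‖q - q₂‖ ≤ d * (2 * r) := by
          rcases le_total ‖q - q₁‖ ‖q - q₂‖ with hm | hm
          · rw [hd', min_eq_left hm]
            gcongr
            exact hle _ e₂
          · rw [hd', min_eq_right hm, mul_comm]
            gcongr
            exact hle _ e₁
        rw [norm_mul, norm_mul]
        calc _ ≤ C / (d / 6) * (d * (2 * r)) := by gcongr
          _ = 6 * C * (2 * r) := by field_simp
          _ ≤ C' := hC' ▸ le_max_left _ _
      · have hqf : q ∈ frontier Ω := by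
          rw [h.isOpen.frontier_eq]
          exact ⟨hqcl, hqΩ⟩
        obtain ⟨s, hs, rfl⟩ := h.exists_eq_of_mem_frontier hqf (by
          rintro rfl
          simp only [sub_self, norm_zero] at hqρ
          linarith [hρ.1])
        refine ⟨_, ?_, (h.tendsto_cauchyInt o hφ hm hs).mul
          ((by fun_prop : Continuous fun z => (z - q₁) * (z - q₂)).continuousAt.mono_left
            nhdsWithin_le_nhds)⟩
        have h1 := hM s (Ioo_subset_Icc_self hs)
        rw [norm_mul, norm_mul, norm_mul, norm_mul, norm_mul, norm_mul, norm_real, Real.norm_eq_abs,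
          o.abs_eq_one, norm_real, norm_I, Real.norm_of_nonneg pi_pos.le, Complex.norm_two]
        refine le_trans ?_ (hC' ▸ le_max_right _ _)
        have h2 := hR2 _ hqcl _ (frontier_subset_closure hq₁)
        have h3 := hR2 _ hqcl _ (frontier_subset_closure hq₂)
        have h4 := h1.trans (le_abs_self M)
        calc _ ≤ 1 * (2 * π * 1) * |M| * ((2 * R) * (2 * R)) := by gcongr
          _ = _ := by ring
  refine ⟨C', fun z hz => ?_⟩
  have hz0 : 0 < ‖z - γ 0‖ := by
    rw [norm_pos_iff, sub_ne_zero]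
    rintro rfl
    exact h.disjoint_frontier hz (h.mem_frontier ⟨le_rfl, two_pi_nonneg⟩)
  have hlim : Tendsto (fun ρ : ℝ => ‖cauchyInt γ φ z‖ * (‖z - γ 0‖ - ρ) ^ 2) (𝓝[>] 0)
      (𝓝 (‖cauchyInt γ φ z‖ * (‖z - γ 0‖ - 0) ^ 2)) :=
    (by fun_prop : Continuous fun ρ : ℝ => ‖cauchyInt γ φ z‖ * (‖z - γ 0‖ - ρ) ^ 2).continuousAt
      |>.mono_left nhdsWithin_le_nhds
  rw [sub_zero] at hlim
  refine le_of_tendsto hlim ?_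
  filter_upwards [Ioo_mem_nhdsGT hr, Ioo_mem_nhdsGT hz0] with ρ h1 h2
  exact step ρ h1 z hz h2.2

end IsBoundaryCurve

/-- A path `w` in `ℂ ∖ {0}` with nondecreasing real part does not wind around the origin. -/
lemma exp_integral_div_of_monotone {w w' : ℝ → ℂ} {T : ℝ} (hT : 0 ≤ T)
    (hw : ∀ t, HasDerivAt w (w' t) t) (hw' : Continuous w') (h0 : ∀ t ∈ Icc 0 T, w t ≠ 0)
    (hmono : MonotoneOn (fun t => (w t).re) (Icc 0 T)) :
    cexp (∫ t in (0 : ℝ)..T, w' t / w t) = w T / w 0 ∧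
      |(∫ t in (0 : ℝ)..T, w' t / w t).im| ≤ 4 * π := by
  have hc : Continuous w := continuous_iff_continuousAt.2 fun t => (hw t).continuousAt
  have h0T : (0 : ℝ) ∈ Icc 0 T := ⟨le_rfl, hT⟩
  have hTT : T ∈ Icc 0 T := ⟨hT, le_rfl⟩
  obtain ⟨τ, hτ, hneg, hpos⟩ : ∃ τ ∈ Icc 0 T, (∀ t ∈ Icc 0 τ, (w t).re ≤ 0 ∨ t = τ ∧ τ = 0) ∧
      ∀ t ∈ Icc τ T, 0 ≤ (w t).re ∨ t = τ ∧ τ = T := by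
    rcases lt_or_ge 0 (w 0).re with h1 | h1
    · refine ⟨0, h0T, fun t ht => .inr ⟨le_antisymm ht.2 ht.1, rfl⟩, fun t ht => .inl ?_⟩
      exact h1.le.trans (hmono h0T ht ht.1)
    rcases lt_or_ge (w T).re 0 with h2 | h2
    · refine ⟨T, hTT, fun t ht => .inl ?_, fun t ht => .inr ⟨le_antisymm ht.2 ht.1, rfl⟩⟩
      exact (hmono ht hTT ht.2).trans h2.le
    obtain ⟨τ, hτ, e⟩ := intermediate_value_Icc hT
      ((continuous_re.comp hc).continuousOn (s := Icc 0 T)) ⟨h1, h2⟩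
    have e' : (w τ).re = 0 := e
    exact ⟨τ, hτ, fun t ht => .inl (e' ▸ hmono ⟨ht.1, ht.2.trans hτ.2⟩ hτ ht.2),
      fun t ht => .inl (e' ▸ hmono hτ ⟨hτ.1.trans ht.1, ht.2⟩ ht.1)⟩
  have hne : ∀ t ∈ Icc 0 T, w t ≠ 0 := h0
  have hii : ∀ a ∈ Icc 0 T, ∀ b ∈ Icc 0 T,
      IntervalIntegrable (fun t => w' t / w t) volume a b := fun a ha b hb =>
    ((hw'.continuousOn.div hc.continuousOn h0).mono
      (ordConnected_Icc.uIcc_subset ha hb)).intervalIntegrable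
  have slit : ∀ z : ℂ, z ≠ 0 → 0 ≤ z.re → z ∈ slitPlane := by
    intro z hz hre
    rcases hre.eq_or_lt with h | h
    · exact .inr fun him => hz (Complex.ext h.symm him)
    · exact .inl h
  have piece₁ : ∃ ℓ : ℂ, ∫ t in (0 : ℝ)..τ, w' t / w t = ℓ ∧ cexp ℓ = w τ / w 0 ∧
      |ℓ.im| ≤ 2 * π := by
    rcases hτ.1.eq_or_lt with h | h
    · refine ⟨0, by rw [← h]; simp, ?_, by simpa using pi_pos.le⟩
      rw [← h, div_self (hne 0 h0T), Complex.exp_zero]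
    have hsl : ∀ t ∈ Icc 0 τ, -w t ∈ slitPlane := fun t ht =>
      slit _ (neg_ne_zero.2 (hne t ⟨ht.1, ht.2.trans hτ.2⟩)) (by
        rw [neg_re]
        rcases hneg t ht with h1 | h1
        · linarith
        · exact absurd h1.2 h.ne')
    refine ⟨Complex.log (-w τ) - Complex.log (-w 0), ?_, ?_, ?_⟩
    · refine intervalIntegral.integral_eq_sub_of_hasDerivAt (f := fun t => Complex.log (-w t))
        (fun t ht => ?_) (hii _ h0T _ hτ)
      rw [uIcc_of_le h.le] at ht
      exact ((hw t).neg.clog_real (hsl t ht)).congr_deriv (neg_div_neg_eq _ _)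
    · rw [Complex.exp_sub, Complex.exp_log (neg_ne_zero.2 (hne τ hτ)),
        Complex.exp_log (neg_ne_zero.2 (hne 0 h0T)), neg_div_neg_eq]
    · rw [sub_im, log_im, log_im]
      refine (abs_sub _ _).trans ?_
      linarith [abs_arg_le_pi (-w τ), abs_arg_le_pi (-w 0)]
  have piece₂ : ∃ ℓ : ℂ, ∫ t in τ..T, w' t / w t = ℓ ∧ cexp ℓ = w T / w τ ∧
      |ℓ.im| ≤ 2 * π := by
    rcases hτ.2.eq_or_lt with h | h
    · refine ⟨0, by rw [h]; simp, ?_, by simpa using pi_pos.le⟩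
      rw [h, div_self (hne T hTT), Complex.exp_zero]
    have hsl : ∀ t ∈ Icc τ T, w t ∈ slitPlane := fun t ht =>
      slit _ (hne t ⟨hτ.1.trans ht.1, ht.2⟩) (by
        rcases hpos t ht with h1 | h1
        · exact h1
        · exact absurd h1.2 h.ne)
    refine ⟨Complex.log (w T) - Complex.log (w τ), ?_, ?_, ?_⟩
    · refine intervalIntegral.integral_eq_sub_of_hasDerivAt (f := fun t => Complex.log (w t))
        (fun t ht => ?_) (hii _ hτ _ hTT)
      rw [uIcc_of_le h.le] at ht
      exact (hw t).clog_real (hsl t ht)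
    · rw [Complex.exp_sub, Complex.exp_log (hne T hTT), Complex.exp_log (hne τ hτ)]
    · rw [sub_im, log_im, log_im]
      refine (abs_sub _ _).trans ?_
      linarith [abs_arg_le_pi (w T), abs_arg_le_pi (w τ)]
  obtain ⟨ℓ₁, i₁, e₁, b₁⟩ := piece₁
  obtain ⟨ℓ₂, i₂, e₂, b₂⟩ := piece₂
  rw [← intervalIntegral.integral_add_adjacent_intervals (hii _ h0T _ hτ) (hii _ hτ _ hTT),
    i₁, i₂]
  refine ⟨?_, ?_⟩
  · rw [Complex.exp_add, e₁, e₂, mul_comm, div_mul_div_cancel₀ (hne τ hτ)]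
  · rw [add_im]
    exact (abs_add_le _ _).trans (by linarith)

lemma half_norm_exp_le_re {z : ℂ} (hz : |z.im| ≤ π / 4) : ‖cexp z‖ / 2 ≤ (cexp z).re := by
  rw [norm_exp, exp_re, ← Real.cos_abs, div_eq_mul_inv, ← one_div]
  have := Real.cos_le_cos_of_nonneg_of_le_pi (abs_nonneg z.im)
    (by linarith [pi_pos] : π / 3 ≤ π) (by linarith [pi_pos])
  rw [Real.cos_pi_div_three] at this
  gcongr

namespace IsBoundaryCurve
variable {Ω U : Set ℂ} {γ γ' φ : ℝ → ℂ} {ς : ℝ}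

/-- A holomorphic barrier at the point `γ 0`: a branch of a root of `(z - γ 0) / (z - b)` with
values in a small sector. -/
lemma exists_barrier (h : IsBoundaryCurve Ω γ γ') : ∃ S : ℂ → ℂ, ∃ b ∈ frontier Ω, b ≠ γ 0 ∧
    DifferentiableOn ℂ S Ω ∧ ∀ z ∈ Ω, S z ≠ 0 ∧ ‖S z‖ / 2 ≤ (S z).re ∧
      ‖(S z)⁻¹‖ / 2 ≤ ((S z)⁻¹).re ∧ ‖S z‖ ^ 16 * ‖z - b‖ = ‖z - γ 0‖ := by
  obtain ⟨δ, hδ, hd⟩ := h.exists_uniform_deriv_close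
  obtain ⟨T, hT⟩ : ∃ T, T = min (δ / 2) (π / 2) := ⟨_, rfl⟩
  have hT0 : 0 < T := hT ▸ lt_min (by positivity) (by positivity)
  have hTδ : T < δ := by
    have := min_le_left (δ / 2) (π / 2)
    rw [← hT] at this
    linarith
  have hTπ : T < π := by
    have := min_le_right (δ / 2) (π / 2)
    rw [← hT] at this
    linarith [pi_pos]
  have hTI : T ∈ Icc 0 (2 * π) := ⟨hT0.le, by linarith⟩
  have hv := h.deriv_ne_zero 0
  have hsub : Icc 0 T ⊆ Icc 0 (2 * π) := Icc_subset_Icc_right hTI.2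
  obtain ⟨E, hE⟩ : ∃ E : ℂ → ℂ, E = fun z => ∫ t in (0 : ℝ)..T, γ' t / (γ t - z) := ⟨_, rfl⟩
  have hEz : ∀ z ∈ Ω, cexp (E z) = (γ T - z) / (γ 0 - z) ∧ |(E z).im| ≤ 4 * π := by
    intro z hz
    have hne : ∀ t ∈ Icc 0 (2 * π), γ t - z ≠ 0 := fun t ht =>
      h.sub_ne_zero_of_notMem (h.disjoint_frontier hz) ht
    have key := exp_integral_div_of_monotone (w := fun t => (γ t - z) / γ' 0)
      (w' := fun t => γ' t / γ' 0) hT0.le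
      (fun t => ((h.hasDerivAt t).sub_const z).div_const _)
      (h.continuous_deriv.div_const _) (fun t ht => div_ne_zero (hne t (hsub ht)) hv) ?_
    · simp only [div_div_div_cancel_right₀ hv] at key
      rw [hE]
      exact key
    · intro s hs t ht hst
      have h1 := h.norm_sub_sub_le (hd 0 ⟨le_rfl, two_pi_nonneg⟩) (s := t) (t := s)
        (by rw [sub_zero, abs_of_nonneg ht.1]; linarith [ht.2])
        (by rw [sub_zero, abs_of_nonneg hs.1]; linarith [hs.2])
      rw [abs_of_nonneg (by linarith)] at h1
      have e : (γ t - z) / γ' 0 - (γ s - z) / γ' 0 =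
          (t - s : ℝ) + (γ t - γ s - (t - s : ℝ) * γ' 0) / γ' 0 := by
        field_simp
        ring
      have h2 : ‖(γ t - γ s - (t - s : ℝ) * γ' 0) / γ' 0‖ ≤ (t - s) / 4 := by
        rw [norm_div, div_le_iff₀ (norm_pos_iff.2 hv)]
        linarith
      have h3 := congrArg re e
      rw [sub_re, add_re, ofReal_re] at h3
      have h4 := (abs_le.1 ((abs_re_le_norm _).trans h2)).1
      show ((γ s - z) / γ' 0).re ≤ ((γ t - z) / γ' 0).re
      linarith
  have hEd : DifferentiableOn ℂ E Ω := fun z hz => by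
    rw [hE]
    exact (h.hasDerivAt_integral_kernel h.continuous_deriv.continuousOn hTI
      (h.disjoint_frontier hz)).differentiableAt.differentiableWithinAt
  refine ⟨fun z => cexp (-E z / 16), γ T, h.mem_frontier hTI, fun e => ?_,
    (hEd.neg.div_const _).cexp, fun z hz => ⟨Complex.exp_ne_zero _, ?_, ?_, ?_⟩⟩
  · have := h.eq_of_apply_eq (s := T) (t := 0) ⟨hT0, by linarith⟩ ⟨le_rfl, two_pi_nonneg⟩ e.symm
    linarith
  · refine half_norm_exp_le_re ?_
    have e : (-E z / 16).im = -(E z).im / 16 := by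
      rw [show (16 : ℂ) = ((16 : ℝ) : ℂ) by norm_num, div_ofReal_im, neg_im]
    rw [e, abs_div, abs_neg, abs_of_pos (by norm_num : (0 : ℝ) < 16)]
    linarith [(hEz z hz).2]
  · rw [← Complex.exp_neg]
    refine half_norm_exp_le_re ?_
    have e : (-(-E z / 16)).im = (E z).im / 16 := by
      rw [neg_div, neg_neg, show (16 : ℂ) = ((16 : ℝ) : ℂ) by norm_num, div_ofReal_im]
    rw [e, abs_div, abs_of_pos (by norm_num : (0 : ℝ) < 16)]
    linarith [(hEz z hz).2]
  · have hne : ∀ t ∈ Icc 0 (2 * π), γ t - z ≠ 0 := fun t ht =>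
      h.sub_ne_zero_of_notMem (h.disjoint_frontier hz) ht
    have e : cexp (-E z / 16) ^ 16 * (z - γ T) = z - γ 0 := by
      rw [← Complex.exp_nat_mul]
      have : ((16 : ℕ) : ℂ) * (-E z / 16) = -E z := by
        push_cast
        ring
      rw [this, Complex.exp_neg, (hEz z hz).1, inv_div, ← neg_sub (γ T) z, mul_neg,
        div_mul_cancel₀ _ (hne T hTI), neg_sub]
    rw [← norm_pow, ← norm_mul, e]

end IsBoundaryCurve

namespace IsBoundaryCurve
variable {Ω U : Set ℂ} {γ γ' φ : ℝ → ℂ} {ς : ℝ}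

/-- A Phragmén–Lindelöf principle at the possible corner `γ 0`. -/
lemma tendsto_zero_of_growth (h : IsBoundaryCurve Ω γ γ') {G : ℂ → ℂ}
    (hG : DifferentiableOn ℂ G Ω) {C : ℝ} (hC : ∀ z ∈ Ω, ‖G z‖ * ‖z - γ 0‖ ^ 2 ≤ C) {g : ℝ → ℂ}
    {M : ℝ} (hM : ∀ s ∈ Ioo 0 (2 * π), ‖g s‖ ≤ M)
    (hlim : ∀ s ∈ Ioo 0 (2 * π), Tendsto G (𝓝[Ω] (γ s)) (𝓝 (g s)))
    (hsmall : ∀ ε > 0, ∃ r > 0, ∀ s ∈ Ioo 0 (2 * π), ‖γ s - γ 0‖ < r → ‖g s‖ ≤ ε) :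
    Tendsto G (𝓝[Ω] (γ 0)) (𝓝 0) := by
  obtain ⟨S, b, hb, hbp, hSd, hS⟩ := h.exists_barrier
  have hne : ∀ q ∈ frontier Ω, ∀ z ∈ Ω, 0 < ‖z - q‖ := fun q hq z hz => by
    rw [norm_pos_iff, sub_ne_zero]
    rintro rfl
    exact h.disjoint_frontier hz hq
  have h0f : γ 0 ∈ frontier Ω := h.mem_frontier ⟨le_rfl, two_pi_nonneg⟩
  have hM0 : 0 ≤ M := (norm_nonneg _).trans (hM π ⟨pi_pos, by linarith [pi_pos]⟩)
  have hSpos : ∀ z ∈ Ω, 0 < ‖S z‖ := fun z hz => norm_pos_iff.2 (hS z hz).1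
  have hself : ∀ᶠ z in 𝓝[Ω] (γ 0), z ∈ Ω := eventually_mem_nhdsWithin
  have hSlim : Tendsto (fun z => ‖S z‖) (𝓝[Ω] (γ 0)) (𝓝[>] 0) := by
    have h1 : Tendsto (fun z => ‖z - γ 0‖ / ‖z - b‖) (𝓝[Ω] (γ 0))
        (𝓝 (‖γ 0 - γ 0‖ / ‖γ 0 - b‖)) := by
      have h2 : ContinuousAt (fun z => ‖z - γ 0‖ / ‖z - b‖) (γ 0) :=
        ContinuousAt.div (by fun_prop) (by fun_prop)
          (norm_ne_zero_iff.2 (sub_ne_zero.2 hbp.symm))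
      exact h2.mono_left nhdsWithin_le_nhds
    rw [sub_self, norm_zero, zero_div] at h1
    refine tendsto_nhdsWithin_iff.2 ⟨Metric.tendsto_nhds.2 fun ε hε => ?_,
      hself.mono fun z hz => hSpos z hz⟩
    filter_upwards [h1.eventually_lt_const (pow_pos hε 16), hself] with z hz hzΩ
    rw [dist_zero_right, norm_norm]
    rw [div_lt_iff₀ (hne b hb z hzΩ), ← (hS z hzΩ).2.2.2] at hz
    exact lt_of_pow_lt_pow_left₀ 16 hε.le (lt_of_mul_lt_mul_right hz (norm_nonneg _))
  obtain ⟨D, hD0, hD⟩ : ∃ D > 0, ∀ z ∈ Ω, ‖z - b‖ ≤ D := by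
    obtain ⟨R, hR⟩ := isBounded_iff_forall_norm_le.1 h.isBounded
    refine ⟨|R| + ‖b‖ + 1, by positivity, fun z hz => (norm_sub_le _ _).trans ?_⟩
    linarith [hR z hz, le_abs_self R]
  have main : ∀ ε > 0, ∃ K, ∀ z ∈ Ω, ‖G z‖ ≤ ε * rexp (K * ‖S z‖) := by
    intro ε hε
    obtain ⟨r, hr, hrs⟩ := hsmall ε hε
    obtain ⟨σ, hσ⟩ : ∃ σ, σ = min 1 (r / (2 * D)) := ⟨_, rfl⟩
    have hσ0 : 0 < σ := hσ ▸ lt_min one_pos (by positivity)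
    have hσS : ∀ z ∈ Ω, r / 2 ≤ ‖z - γ 0‖ → σ ≤ ‖S z‖ := by
      intro z hz hzr
      rcases le_total 1 ‖S z‖ with h1 | h1
      · exact (hσ ▸ min_le_left _ _ : σ ≤ 1).trans h1
      · refine (hσ ▸ min_le_right _ _ : σ ≤ r / (2 * D)).trans ?_
        rw [div_le_iff₀ (by positivity)]
        have h2 : ‖S z‖ ^ 16 ≤ ‖S z‖ := by
          simpa using pow_le_pow_of_le_one (norm_nonneg _) h1 (by norm_num : 1 ≤ 16)
        have h3 := (hS z hz).2.2.2
        have h4 : ‖S z‖ ^ 16 * ‖z - b‖ ≤ ‖S z‖ * D := by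
          gcongr
          exact hD z hz
        linarith
    obtain ⟨K, hK⟩ : ∃ K, K = 2 / σ * (M / ε) := ⟨_, rfl⟩
    have hK0 : 0 ≤ K := hK ▸ by positivity
    have hKσ : M * rexp (-(K * (σ / 2))) ≤ ε := by
      have e : K * (σ / 2) = M / ε := by
        rw [hK]
        field_simp
      rw [e, Real.exp_neg, ← div_eq_mul_inv, div_le_iff₀ (Real.exp_pos _)]
      have := Real.add_one_le_exp (M / ε)
      calc M = ε * (M / ε) := by field_simp
        _ ≤ _ := by gcongr; linarith
    refine ⟨K, fun z hz => ?_⟩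
    have hη : ∀ η > 0, ‖G z‖ * rexp (-(K * (S z).re) - η * ((S z)⁻¹).re) ≤ ε := by
      intro η hη
      have hnorm : ∀ z, ‖G z * cexp (-(K * S z) - η * (S z)⁻¹)‖ =
          ‖G z‖ * rexp (-(K * (S z).re) - η * ((S z)⁻¹).re) := fun z => by
        rw [norm_mul, norm_exp, sub_re, neg_re, re_ofReal_mul, re_ofReal_mul]
      have hre : ∀ z ∈ Ω, 0 ≤ (S z).re ∧ 0 ≤ ((S z)⁻¹).re := fun z hz =>
        ⟨(by positivity : 0 ≤ ‖S z‖ / 2).trans (hS z hz).2.1,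
          (by positivity : 0 ≤ ‖(S z)⁻¹‖ / 2).trans (hS z hz).2.2.1⟩
      rw [← hnorm]
      refine norm_le_of_eventually_norm_le (H := fun z => G z * cexp (-(K * S z) - η * (S z)⁻¹))
        h.isOpen h.isBounded
        (hG.mul ((((hSd.const_mul _).neg).sub ((hSd.inv fun z hz => (hS z hz).1).const_mul
          _)).cexp)) (fun q hq ε' hε' => ?_) hz
      by_cases hqp : q = γ 0
      · rw [hqp]
        have hx : Tendsto (fun z => ‖S z‖⁻¹) (𝓝[Ω] (γ 0)) atTop := hSlim.inv_tendsto_nhdsGT_zero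
        have hd0 : 0 < ‖γ 0 - b‖ := norm_pos_iff.2 (sub_ne_zero.2 hbp.symm)
        have hdl : ∀ᶠ z in 𝓝[Ω] (γ 0), ‖γ 0 - b‖ / 2 < ‖z - b‖ :=
          ((by fun_prop : Continuous fun z => ‖z - b‖).continuousAt.mono_left
            nhdsWithin_le_nhds : Tendsto _ _ _).eventually_const_lt (by linarith)
        have hz0 := ((tendsto_rpow_mul_exp_neg_mul_atTop_nhds_zero 32 (η / 2)
          (by positivity)).comp hx).const_mul (|C| * (4 / ‖γ 0 - b‖ ^ 2))
        rw [mul_zero] at hz0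
        filter_upwards [hz0.eventually_lt_const (show 0 < ε + ε' by linarith), hdl, hself]
          with z h1 h2 hz
        refine le_trans ?_ h1.le
        rw [hnorm]
        simp only [Function.comp_apply]
        have hSz := hSpos z hz
        have hbz := hne b hb z hz
        have h3 : ‖G z‖ ≤ |C| * (4 / ‖γ 0 - b‖ ^ 2) * ‖S z‖⁻¹ ^ 32 := by
          have h4 := (hC z hz).trans (le_abs_self C)
          rw [← le_div_iff₀ (pow_pos (hne _ h0f z hz) 2), ← (hS z hz).2.2.2] at h4
          refine h4.trans ?_
          have h5 : (‖γ 0 - b‖ / 2) ^ 2 ≤ ‖z - b‖ ^ 2 := by gcongr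
          calc |C| / (‖S z‖ ^ 16 * ‖z - b‖) ^ 2 = |C| * (1 / ‖z - b‖ ^ 2) * ‖S z‖⁻¹ ^ 32 := by
                field_simp
            _ ≤ |C| * (1 / (‖γ 0 - b‖ / 2) ^ 2) * ‖S z‖⁻¹ ^ 32 := by gcongr
            _ = _ := by
                congr 2
                field_simp
                norm_num
        have h6 : rexp (-(K * (S z).re) - η * ((S z)⁻¹).re) ≤ rexp (-(η / 2) * ‖S z‖⁻¹) := by
          rw [Real.exp_le_exp]
          have h7 := (hS z hz).2.2.1
          rw [norm_inv] at h7
          have h8 := mul_nonneg hK0 (hre z hz).1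
          nlinarith
        have h9 : ‖S z‖⁻¹ ^ (32 : ℝ) = ‖S z‖⁻¹ ^ (32 : ℕ) := by
          rw [← Real.rpow_natCast]
          norm_num
        rw [h9, ← mul_assoc]
        gcongr
      · obtain ⟨s, hs, rfl⟩ := h.exists_eq_of_mem_frontier hq hqp
        have hev : ∀ᶠ z in 𝓝[Ω] (γ s), ‖G z‖ < ‖g s‖ + ε' :=
          (hlim s hs).norm.eventually_lt_const (by linarith)
        by_cases hsr : ‖γ s - γ 0‖ < r
        · filter_upwards [hev, eventually_mem_nhdsWithin] with z hz hzΩ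
          rw [hnorm]
          have h1 : rexp (-(K * (S z).re) - η * ((S z)⁻¹).re) ≤ 1 := by
            rw [Real.exp_le_one_iff]
            have h8 := mul_nonneg hK0 (hre z hzΩ).1
            have h9 := mul_nonneg hη.le (hre z hzΩ).2
            linarith
          have := mul_le_mul_of_nonneg_left h1 (norm_nonneg (G z))
          linarith [hrs s hs hsr]
        · have hdl : ∀ᶠ z in 𝓝[Ω] (γ s), r / 2 < ‖z - γ 0‖ :=
            ((by fun_prop : Continuous fun z => ‖z - γ 0‖).continuousAt.mono_left
              nhdsWithin_le_nhds : Tendsto _ _ _).eventually_const_lt (by linarith)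
          filter_upwards [hev, eventually_mem_nhdsWithin, hdl] with z hz hzΩ hzr
          rw [hnorm]
          have h1 : rexp (-(K * (S z).re) - η * ((S z)⁻¹).re) ≤ rexp (-(K * (σ / 2))) := by
            rw [Real.exp_le_exp]
            have h7 := (hS z hzΩ).2.1
            have h8 := hσS z hzΩ hzr.le
            have h9 := mul_nonneg hη.le (hre z hzΩ).2
            have := mul_le_mul_of_nonneg_left (show σ / 2 ≤ (S z).re by linarith) hK0
            linarith
          have h2 : rexp (-(K * (σ / 2))) ≤ 1 := by
            rw [Real.exp_le_one_iff]
            have : 0 ≤ K * (σ / 2) := by positivity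
            linarith
          calc _ ≤ (M + ε') * rexp (-(K * (σ / 2))) := by
                gcongr
                linarith [hM s hs]
            _ = M * rexp (-(K * (σ / 2))) + ε' * rexp (-(K * (σ / 2))) := by ring
            _ ≤ ε + ε' * 1 := by gcongr
            _ = _ := by ring
    have hlim0 : Tendsto (fun η : ℝ => ‖G z‖ * rexp (-(K * (S z).re) - η * ((S z)⁻¹).re))
        (𝓝[>] 0) (𝓝 (‖G z‖ * rexp (-(K * (S z).re) - 0 * ((S z)⁻¹).re))) :=
      (by fun_prop : Continuous fun η : ℝ =>
        ‖G z‖ * rexp (-(K * (S z).re) - η * ((S z)⁻¹).re)).continuousAt.mono_left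
          nhdsWithin_le_nhds
    have h1 := le_of_tendsto hlim0 (eventually_mem_nhdsWithin.mono fun η hη' => hη η hη')
    rw [zero_mul, sub_zero, Real.exp_neg, ← div_eq_mul_inv, div_le_iff₀ (Real.exp_pos _)] at h1
    refine h1.trans ?_
    gcongr
    exact (le_abs_self _).trans (abs_re_le_norm _)
  rw [Metric.tendsto_nhds]
  intro ε hε
  obtain ⟨K, hK⟩ := main (ε / 2) (by positivity)
  have h1 : Tendsto (fun z => ε / 2 * rexp (K * ‖S z‖)) (𝓝[Ω] (γ 0))
      (𝓝 (ε / 2 * rexp (K * 0))) :=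
    (((hSlim.mono_right nhdsWithin_le_nhds).const_mul K).rexp).const_mul _
  rw [mul_zero, Real.exp_zero, mul_one] at h1
  filter_upwards [h1.eventually_lt_const (show ε / 2 < ε by linarith), hself] with z hz hzΩ
  rw [dist_zero_right]
  exact (hK z hzΩ).trans_lt hz

/-- Sufficiency of the moment conditions. -/
theorem exists_extension (h : IsBoundaryCurve Ω γ γ') {f : ℂ → ℂ}
    (hf : ContinuousOn f (frontier Ω))
    (hm : ∀ m : ℕ, ∫ t in (0 : ℝ)..(2 * π), γ t ^ m * (f (γ t) * γ' t) = 0) :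
    ∃ F : ℂ → ℂ, ContinuousOn F (closure Ω) ∧ DifferentiableOn ℂ F Ω ∧
      EqOn F f (frontier Ω) := by
  obtain ⟨ς, U, o⟩ := h.exists_isOuterSide
  have hfγ : ContinuousOn (fun t => f (γ t)) (Icc 0 (2 * π)) :=
    hf.comp h.continuous.continuousOn fun t ht => h.mem_frontier ht
  have hφ : ContinuousOn (fun t => f (γ t) * γ' t) (Icc 0 (2 * π)) :=
    hfγ.mul h.continuous_deriv.continuousOn
  obtain ⟨k, hk⟩ : ∃ k : ℂ, k = ς * (2 * π * I) := ⟨_, rfl⟩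
  have hk0 : k ≠ 0 := by
    have : (ς : ℂ) ≠ 0 := ofReal_ne_zero.2 fun e => by
      have := o.abs_eq_one
      simp [e] at this
    rw [hk]
    exact mul_ne_zero this two_pi_I_ne_zero
  obtain ⟨F, hF⟩ : ∃ F : ℂ → ℂ, F = fun z => cauchyInt γ (fun t => f (γ t) * γ' t) z / k :=
    ⟨_, rfl⟩
  have hFd : DifferentiableOn ℂ F Ω := hF ▸
    ((h.differentiableOn_cauchyInt hφ).mono h.disjoint_frontier).div_const k
  have hlim : ∀ s ∈ Ioo 0 (2 * π), Tendsto F (𝓝[Ω] (γ s)) (𝓝 (f (γ s))) := fun s hs => by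
    have := (h.tendsto_cauchyInt o hφ hm hs).div_const k
    rw [← hk, mul_div_cancel_right₀ _ (h.deriv_ne_zero s), mul_div_cancel_left₀ _ hk0] at this
    exact hF ▸ this
  obtain ⟨M, hM⟩ := h.isCompact_frontier.exists_bound_of_continuousOn hf
  have h0f : γ 0 ∈ frontier Ω := h.mem_frontier ⟨le_rfl, two_pi_nonneg⟩
  have hlim0 : Tendsto (fun z => F z - f (γ 0)) (𝓝[Ω] (γ 0)) (𝓝 0) := by
    obtain ⟨C, hC⟩ := h.exists_norm_cauchyInt_mul_sq_le o hφ hm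
    obtain ⟨R, hR⟩ := isBounded_iff_forall_norm_le.1 h.isBounded
    refine h.tendsto_zero_of_growth (C := C / ‖k‖ + M * (|R| + ‖γ 0‖) ^ 2) (M := M + M)
      (g := fun s => f (γ s) - f (γ 0)) (hFd.sub_const _)
      (fun z hz => ?_) (fun s hs => ?_) (fun s hs => (hlim s hs).sub_const _) fun ε hε => ?_
    · have h1 : ‖F z - f (γ 0)‖ ≤ ‖F z‖ + M := (norm_sub_le _ _).trans (by gcongr; exact hM _ h0f)
      have h2 : ‖F z‖ * ‖z - γ 0‖ ^ 2 ≤ C / ‖k‖ := by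
        rw [hF]
        simp only [norm_div]
        rw [div_mul_eq_mul_div]
        gcongr
        exact hC z hz
      have h3 : ‖z - γ 0‖ ≤ |R| + ‖γ 0‖ := (norm_sub_le _ _).trans
        (by gcongr; exact (hR z hz).trans (le_abs_self R))
      have hM0 := (norm_nonneg _).trans (hM _ h0f)
      calc _ ≤ (‖F z‖ + M) * ‖z - γ 0‖ ^ 2 := by gcongr
        _ = ‖F z‖ * ‖z - γ 0‖ ^ 2 + M * ‖z - γ 0‖ ^ 2 := by ring
        _ ≤ _ := by gcongr
    · exact (norm_sub_le _ _).trans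
        (add_le_add (hM _ (h.mem_frontier (Ioo_subset_Icc_self hs))) (hM _ h0f))
    · obtain ⟨r, hr, hrs⟩ := Metric.continuousWithinAt_iff.1 (hf _ h0f) ε hε
      refine ⟨r, hr, fun s hs hsr => ?_⟩
      rw [← dist_eq_norm]
      exact (hrs (h.mem_frontier (Ioo_subset_Icc_self hs)) (by rwa [dist_eq_norm])).le
  have hlim' : ∀ q ∈ frontier Ω, Tendsto F (𝓝[Ω] q) (𝓝 (f q)) := by
    intro q hq
    by_cases hq0 : q = γ 0
    · rw [hq0]
      simpa using hlim0.add_const (f (γ 0))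
    · obtain ⟨s, hs, rfl⟩ := h.exists_eq_of_mem_frontier hq hq0
      exact hlim s hs
  classical
  have heq : EqOn (Ω.piecewise F f) F Ω := fun z hz => piecewise_eq_of_mem _ _ _ hz
  have heqf : EqOn (Ω.piecewise F f) f (frontier Ω) := fun z hz =>
    piecewise_eq_of_notMem _ _ _ fun hz' => h.disjoint_frontier hz' hz
  refine ⟨Ω.piecewise F f, fun q hq => ?_, hFd.congr heq, heqf⟩
  by_cases hqΩ : q ∈ Ω
  · exact ((hFd.continuousOn.congr heq).continuousAt (h.isOpen.mem_nhds hqΩ)).continuousWithinAt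
  · have hqf : q ∈ frontier Ω := by
      rw [h.isOpen.frontier_eq]
      exact ⟨hq, hqΩ⟩
    rw [closure_eq_self_union_frontier, ContinuousWithinAt, nhdsWithin_union]
    refine Tendsto.sup ?_ ?_
    · rw [heqf hqf]
      exact (hlim' q hqf).congr' (heq.symm.eventuallyEq_of_mem self_mem_nhdsWithin)
    · exact (hf q hqf).congr heqf (heqf hqf)

end IsBoundaryCurve

/-- The Cauchy-Riemann operator `∂ₓ + i ∂_y`, applied to a real valued function. -/
def dbar (ψ : ℂ → ℝ) (z : ℂ) : ℂ := (fderiv ℝ ψ z 1 : ℂ) + I * (fderiv ℝ ψ z I : ℂ)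

/-- Green's formula on `Ω` for the form `ψ F dz`, where `F` is holomorphic. -/
def GreenFor (Ω : Set ℂ) (γ γ' : ℝ → ℂ) (ς : ℝ) (F : ℂ → ℂ) (ψ : ℂ → ℝ) : Prop :=
  ∫ t in (0 : ℝ)..(2 * π), F (γ t) * ψ (γ t) * γ' t = ς * I * ∫ z in Ω, F z * dbar ψ z

lemma continuous_dbar {ψ : ℂ → ℝ} (hψ : ContDiff ℝ 1 ψ) : Continuous (dbar ψ) := by
  have h1 := hψ.continuous_fderiv one_ne_zero
  unfold dbar
  have h2 : Continuous fun z => fderiv ℝ ψ z 1 := h1.clm_apply continuous_const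
  have h3 : Continuous fun z => fderiv ℝ ψ z I := h1.clm_apply continuous_const
  fun_prop

lemma dbar_eq_zero_of_notMem_tsupport {ψ : ℂ → ℝ} {z : ℂ} (hz : z ∉ tsupport ψ) :
    dbar ψ z = 0 := by
  have : fderiv ℝ ψ z = 0 := image_eq_zero_of_notMem_tsupport
    fun h => hz (tsupport_fderiv_subset ℝ h)
  simp [dbar, this]

lemma dbar_congr {ψ φ : ℂ → ℝ} {z : ℂ} (h : ψ =ᶠ[𝓝 z] φ) : dbar ψ z = dbar φ z := by
  simp [dbar, h.fderiv_eq]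

lemma integral_fderiv_eq_zero {G : ℂ → ℂ} (hG : ContDiff ℝ 1 G) (hc : HasCompactSupport G)
    (v : ℂ) : ∫ z, fderiv ℝ G z v = 0 := by
  have h1 : Continuous fun z => fderiv ℝ G z v :=
    (hG.continuous_fderiv one_ne_zero).clm_apply continuous_const
  have h2 : HasCompactSupport fun z => fderiv ℝ G z v := hc.fderiv_apply ℝ v
  have := integral_mul_fderiv_eq_neg_fderiv_mul_of_integrable (μ := volume) (𝕜 := ℂ)
    (f := fun _ : ℂ => (1 : ℂ)) (g := G) (v := v) (by simp)
    (by simpa using h1.integrable_of_hasCompactSupport h2)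
    (by simpa using hG.continuous.integrable_of_hasCompactSupport hc)
    (fun x _ => differentiableAt_const _) (fun x _ => hG.differentiable one_ne_zero x)
  simpa using this

namespace IsBoundaryCurve

variable {Ω U : Set ℂ} {γ γ' : ℝ → ℂ} {ς : ℝ} {F : ℂ → ℂ} {ψ : ℂ → ℝ}

lemma hasFDerivAt_mul_ofReal {F' : ℂ} {z : ℂ} (hF : HasDerivAt F F' z)
    (hψ : DifferentiableAt ℝ ψ z) :
    HasFDerivAt (fun z => F z * (ψ z : ℂ))
      (F z • (ofRealCLM.comp (fderiv ℝ ψ z)) +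
        (ψ z : ℂ) • ((ContinuousLinearMap.toSpanSingleton ℂ F').restrictScalars ℝ)) z := by
  have h1 : HasFDerivAt F ((ContinuousLinearMap.toSpanSingleton ℂ F').restrictScalars ℝ) z :=
    hF.hasFDerivAt.restrictScalars ℝ
  have h2 : HasFDerivAt (fun z => (ψ z : ℂ)) (ofRealCLM.comp (fderiv ℝ ψ z)) z :=
    ofRealCLM.hasFDerivAt.comp z hψ.hasFDerivAt
  exact h1.mul h2

lemma greenFor_of_tsupport_subset (h : IsBoundaryCurve Ω γ γ')
    (hFd : DifferentiableOn ℂ F Ω) (hψ : ContDiff ℝ 1 ψ) (hs : tsupport ψ ⊆ Ω) :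
    GreenFor Ω γ γ' ς F ψ := by
  have hc : HasCompactSupport ψ :=
    Metric.isCompact_of_isClosed_isBounded (isClosed_tsupport _) (h.isBounded.subset hs)
  have hL : ∫ t in (0 : ℝ)..(2 * π), F (γ t) * ψ (γ t) * γ' t = 0 := by
    rw [intervalIntegral.integral_congr (g := fun _ => (0 : ℂ)), intervalIntegral.integral_zero]
    intro t ht
    rw [uIcc_of_le two_pi_nonneg] at ht
    have : ψ (γ t) = 0 := image_eq_zero_of_notMem_tsupport
      fun h' => h.disjoint_frontier (hs h') (h.mem_frontier ht)
    simp [this]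
  have hsG : tsupport (fun z => F z * (ψ z : ℂ)) ⊆ tsupport ψ := by
    refine closure_mono fun z hz => ?_
    rw [Function.mem_support] at hz ⊢
    exact fun h0 => hz (by simp [h0])
  have hG : ContDiff ℝ 1 fun z => F z * (ψ z : ℂ) := by
    rw [contDiff_iff_contDiffAt]
    intro z
    by_cases hz : z ∈ tsupport ψ
    · have h1 : ContDiffAt ℂ 1 F z := (hFd.analyticAt (h.isOpen.mem_nhds (hs hz))).contDiffAt
      exact (h1.restrict_scalars ℝ).mul (ofRealCLM.contDiff.comp hψ).contDiffAt
    · refine contDiffAt_const (c := (0 : ℂ)) |>.congr_of_eventuallyEq ?_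
      filter_upwards [notMem_tsupport_iff_eventuallyEq.1 hz] with w hw
      simp [hw]
  have hGc : HasCompactSupport fun z => F z * (ψ z : ℂ) :=
    hc.of_isClosed_subset (isClosed_tsupport _) hsG
  have key : ∀ z, F z * dbar ψ z = fderiv ℝ (fun z => F z * (ψ z : ℂ)) z 1 +
      I * fderiv ℝ (fun z => F z * (ψ z : ℂ)) z I := by
    intro z
    by_cases hz : z ∈ tsupport ψ
    · have h1 := (hFd.differentiableAt (h.isOpen.mem_nhds (hs hz))).hasDerivAt
      rw [(hasFDerivAt_mul_ofReal h1 (hψ.differentiable one_ne_zero z)).fderiv]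
      simp [dbar]
      linear_combination (-(ψ z : ℂ) * deriv F z) * I_mul_I
    · have : fderiv ℝ (fun z => F z * (ψ z : ℂ)) z = 0 := image_eq_zero_of_notMem_tsupport
        fun h' => hz (hsG (tsupport_fderiv_subset ℝ h'))
      rw [dbar_eq_zero_of_notMem_tsupport hz, this]; simp
  have hi : ∀ v : ℂ, Integrable fun z => fderiv ℝ (fun z => F z * (ψ z : ℂ)) z v := fun v =>
    ((hG.continuous_fderiv one_ne_zero).clm_apply continuous_const).integrable_of_hasCompactSupport
      (hGc.fderiv_apply ℝ v)
  rw [GreenFor, hL, setIntegral_eq_integral_of_forall_compl_eq_zero, integral_congr_ae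
    (.of_forall key), integral_add (hi 1) ((hi I).const_mul I), integral_const_mul,
    integral_fderiv_eq_zero hG hGc, integral_fderiv_eq_zero hG hGc]
  · simp
  · intro z hz
    rw [dbar_eq_zero_of_notMem_tsupport fun h' => hz (hs h'), mul_zero]

end IsBoundaryCurve

/-- Green's formula on a rectangle, for functions vanishing on three of its sides. -/
lemma integral_eq_neg_integral_rectangle {a b r : ℝ} (hab : a ≤ b) (hr : 0 < r) {g : ℝ → ℂ} {κ : ℂ}
    {P P₁ P₂ Q : ℂ → ℂ} (hg : Continuous g) (hP : Continuous P) (hQ : Continuous Q)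
    (h₁ : ∀ s ∈ Icc a b, ∀ y ∈ Ioo 0 r,
      HasDerivAt (fun s : ℝ => P (s + y * I)) (P₁ (s + y * I)) s)
    (h₂ : ∀ s ∈ Icc a b, ∀ y ∈ Ioo 0 r,
      HasDerivAt (fun y : ℝ => P (s + y * I)) (P₂ (s + y * I)) y)
    (c₁ : ContinuousOn P₁ (Icc a b ×ℂ Ioo 0 r)) (c₂ : ContinuousOn P₂ (Icc a b ×ℂ Ioo 0 r))
    (e : ∀ s ∈ Icc a b, ∀ y ∈ Ioo 0 r,
      g s * P₂ (s + y * I) = κ * P₁ (s + y * I) + Q (s + y * I))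
    (ha : ∀ y ∈ Ioo 0 r, P (a + y * I) = 0) (hb : ∀ y ∈ Ioo 0 r, P (b + y * I) = 0)
    (htop : ∀ s ∈ Icc a b, P (s + r * I) = 0) :
    ∫ s in a..b, g s * P s = - ∫ y in (0 : ℝ)..r, ∫ s in a..b, Q (s + y * I) := by
  have hmem : ∀ s ∈ Icc a b, ∀ y ∈ Ioo 0 r, (s + y * I : ℂ) ∈ Icc a b ×ℂ Ioo 0 r := fun s hs y hy =>
    Complex.mem_reProdIm.2 ⟨by simpa using hs, by simpa using hy⟩
  have hsl : ∀ {P : ℂ → ℂ}, ContinuousOn P (Icc a b ×ℂ Ioo 0 r) → ∀ y ∈ Ioo 0 r,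
      ContinuousOn (fun s : ℝ => P (s + y * I)) (Icc a b) := fun hc y hy =>
    hc.comp (f := fun s : ℝ => (s + y * I : ℂ)) (by fun_prop) fun s hs => hmem s hs y hy
  have hsub : uIoc a b ⊆ Icc a b := by rw [uIoc_of_le hab]; exact Ioc_subset_Icc_self
  have hcL : Continuous fun y : ℝ => ∫ s in a..b, g s * P (s + y * I) := by
    refine intervalIntegral.continuous_parametric_intervalIntegral_of_continuous'
      (f := fun y s : ℝ => g s * P (s + y * I)) ?_ a b
    unfold Function.uncurry
    fun_prop
  have hcR : Continuous fun y : ℝ => ∫ s in a..b, Q (s + y * I) := by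
    refine intervalIntegral.continuous_parametric_intervalIntegral_of_continuous'
      (f := fun y s : ℝ => Q (s + y * I)) ?_ a b
    unfold Function.uncurry
    fun_prop
  have hderiv : ∀ y ∈ Ioo 0 r, HasDerivAt (fun y : ℝ => ∫ s in a..b, g s * P (s + y * I))
      (∫ s in a..b, Q (s + y * I)) y := by
    intro y hy
    have hI : Icc (y / 2) ((y + r) / 2) ⊆ Ioo 0 r := fun x hx =>
      ⟨by linarith [hx.1, hy.1], by linarith [hx.2, hy.2]⟩
    have hK : IsCompact (Icc a b ×ℂ Icc (y / 2) ((y + r) / 2)) :=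
      isCompact_Icc.reProdIm isCompact_Icc
    have hc : ContinuousOn (fun w : ℂ => g w.re * P₂ w) (Icc a b ×ℂ Ioo 0 r) :=
      ContinuousOn.mul (by fun_prop) c₂
    obtain ⟨M, hM⟩ := hK.exists_bound_of_continuousOn (hc.mono fun w hw =>
      Complex.mem_reProdIm.2 ⟨(Complex.mem_reProdIm.1 hw).1, hI (Complex.mem_reProdIm.1 hw).2⟩)
    have hd := (intervalIntegral.hasDerivAt_integral_of_dominated_loc_of_deriv_le (𝕜 := ℝ)
      (F := fun y s : ℝ => g s * P (s + y * I)) (F' := fun y s : ℝ => g s * P₂ (s + y * I))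
      (x₀ := y) (bound := fun _ => M) (a := a) (b := b) (μ := volume)
      (Icc_mem_nhds (by linarith [hy.1]) (by linarith [hy.2]) : Icc (y / 2) ((y + r) / 2) ∈ 𝓝 y)
      ?_ ?_ ?_ ?_ ?_ ?_).2
    · refine hd.congr_deriv ?_
      rw [intervalIntegral.integral_congr (g := fun s : ℝ => κ * P₁ (s + y * I) + Q (s + y * I))
        (fun s hs => e s (by rwa [uIcc_of_le hab] at hs) y hy),
        intervalIntegral.integral_add, intervalIntegral.integral_const_mul,
        intervalIntegral.integral_eq_sub_of_hasDerivAt (f := fun s : ℝ => P (s + y * I)), ha y hy,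
        hb y hy]
      · simp
      · intro s hs
        exact h₁ s (by rwa [uIcc_of_le hab] at hs) y hy
      · exact ContinuousOn.intervalIntegrable (by rw [uIcc_of_le hab]; exact hsl c₁ y hy)
      · exact ContinuousOn.intervalIntegrable
          (by rw [uIcc_of_le hab]; exact (hsl c₁ y hy).const_mul κ)
      · exact Continuous.intervalIntegrable (by fun_prop) _ _
    · refine .of_forall fun x => Continuous.aestronglyMeasurable ?_
      fun_prop
    · exact Continuous.intervalIntegrable (by fun_prop) _ _
    · exact ((hg.continuousOn.mul (hsl c₂ y hy)).mono hsub).aestronglyMeasurable measurableSet_uIoc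
    · refine .of_forall fun s hs x hx => ?_
      have := hM (s + x * I)
        (Complex.mem_reProdIm.2 ⟨by simpa using hsub hs, by simpa using hx⟩)
      simpa using this
    · exact intervalIntegrable_const
    · exact .of_forall fun s hs x hx => (h₂ s (hsub hs) x (hI hx)).const_mul _
  rw [intervalIntegral.integral_eq_sub_of_hasDerivAt_of_le hr.le hcL.continuousOn hderiv
    (hcR.intervalIntegrable _ _), intervalIntegral.integral_congr (a := a) (b := b)
    (f := fun s : ℝ => g s * P (s + r * I)) (g := fun _ => (0 : ℂ))]
  · simp
  · intro s hs
    rw [uIcc_of_le hab] at hs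
    simp [htop s hs]

/-- Fubini's theorem on a rectangle in the complex plane. -/
lemma setIntegral_reProdIm {a b c d : ℝ} (hab : a ≤ b) (hcd : c ≤ d) {Q : ℂ → ℂ}
    (hQ : Continuous Q) :
    ∫ w in Ioo a b ×ℂ Ioo c d, Q w = ∫ y in c..d, ∫ s in a..b, Q (s + y * I) := by
  have e : Ioo a b ×ℂ Ioo c d = measurableEquivRealProd ⁻¹' (Ioo a b ×ˢ Ioo c d) := by
    ext w; simp [Complex.mem_reProdIm]
  have h1 := (Complex.volume_preserving_equiv_real_prod).setIntegral_preimage_emb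
    measurableEquivRealProd.measurableEmbedding
    (fun p : ℝ × ℝ => Q (p.1 + p.2 * I)) (Ioo a b ×ˢ Ioo c d)
  rw [← e] at h1
  have hi : IntegrableOn (fun p : ℝ × ℝ => Q (p.1 + p.2 * I)) (Ioo a b ×ˢ Ioo c d)
      (volume.prod volume) := by
    have hc : Continuous (fun p : ℝ × ℝ => Q (p.1 + p.2 * I)) := by fun_prop
    exact (hc.continuousOn.integrableOn_compact (isCompact_Icc.prod isCompact_Icc)).mono_set
      (prod_mono Ioo_subset_Icc_self Ioo_subset_Icc_self)
  rw [Measure.volume_eq_prod, ← setIntegral_prod_swap, setIntegral_prod] at h1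
  · simp only [measurableEquivRealProd_apply, re_add_im] at h1
    rw [h1, intervalIntegral.integral_of_le hcd, integral_Ioc_eq_integral_Ioo]
    refine integral_congr_ae (.of_forall fun y => ?_)
    simp only [Prod.fst_swap, Prod.snd_swap]
    rw [intervalIntegral.integral_of_le hab, integral_Ioc_eq_integral_Ioo]
  · exact hi.swap

namespace IsBoundaryCurve

variable {Ω U : Set ℂ} {γ γ' : ℝ → ℂ} {ς : ℝ} {F : ℂ → ℂ} {ψ : ℂ → ℝ}

lemma fderiv_mul_sub_fderiv_mul (v κ z : ℂ) :
    v * (fderiv ℝ ψ z κ : ℂ) =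
      κ * (fderiv ℝ ψ z v : ℂ) + -I * ((v.re * κ.im - v.im * κ.re : ℝ) : ℂ) * dbar ψ z := by
  have hv : ∀ u : ℂ, fderiv ℝ ψ z u = u.re * fderiv ℝ ψ z 1 + u.im * fderiv ℝ ψ z I := fun u => by
    conv_lhs => rw [show u = u.re • (1 : ℂ) + u.im • I by simp]
    rw [map_add, map_smul, map_smul]; rfl
  rw [hv v, hv κ, dbar]
  apply Complex.ext <;> simp <;> ring

lemma rect_mono {s₀ r ρ : ℝ} (hr : r ≤ ρ) : rect s₀ r ⊆ rect s₀ ρ :=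
  fun _ hw => ⟨hw.1.trans_le hr, hw.2.trans_le hr⟩

lemma IsChart.apply_notMem_tsupport {s₀ δ ρ r : ℝ} (ch : IsChart γ γ' s₀ δ ρ)
    (h : IsBoundaryCurve Ω γ γ') (hς : |ς| = 1) (hr : r ≤ ρ)
    (hs : tsupport ψ ⊆ tubeMap γ (ς * I * γ' s₀) '' rect s₀ r) {w : ℂ} (hw : w ∈ rect s₀ ρ)
    (hw' : w ∉ rect s₀ r) : tubeMap γ (ς * I * γ' s₀) w ∉ tsupport ψ := fun hm => by
  obtain ⟨u, hu, e⟩ := hs hm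
  rw [ch.injOn h hς (ch.rect_subset (rect_mono hr hu)) (ch.rect_subset hw) e] at hu
  exact hw' hu

lemma IsChart.integral_curve_eq {s₀ δ ρ r : ℝ} (ch : IsChart γ γ' s₀ δ ρ)
    (h : IsBoundaryCurve Ω γ γ') (hς : |ς| = 1) (hr0 : 0 < r) (hr : r < ρ)
    (hs : tsupport ψ ⊆ tubeMap γ (ς * I * γ' s₀) '' rect s₀ r) :
    ∫ t in (0 : ℝ)..(2 * π), F (γ t) * ψ (γ t) * γ' t =
      ∫ t in (s₀ - r)..(s₀ + r), γ' t * (F (γ t) * ψ (γ t)) := by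
  have hl := ch.lt_left
  have hl' := ch.lt_right
  have hl'' := ch.rho_le
  rw [intervalIntegral.integral_of_le two_pi_nonneg, intervalIntegral.integral_of_le (by linarith),
    setIntegral_eq_of_subset_of_forall_sdiff_eq_zero (s := Ioc (s₀ - r) (s₀ + r)) measurableSet_Ioc]
  · exact integral_congr_ae (.of_forall fun t => mul_comm _ _)
  · exact Ioc_subset_Ioc (by linarith) (by linarith)
  · rintro t ⟨ht, ht'⟩
    have : ψ (γ t) = 0 := image_eq_zero_of_notMem_tsupport fun hm => by
      obtain ⟨w, hw, e⟩ := hs hm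
      rw [ch.exists_eq_of_mem_frontier h hς (rect_mono hr.le hw) (Ioc_subset_Icc_self ht) e.symm]
        at hw
      have := abs_lt.1 hw.1
      rw [ofReal_re] at this
      exact ht' ⟨by linarith, by linarith⟩
    simp [this]

lemma IsOuterSide.setIntegral_eq (o : IsOuterSide Ω γ γ' ς U) (h : IsBoundaryCurve Ω γ γ')
    {s₀ δ ρ r : ℝ} (ch : IsChart γ γ' s₀ δ ρ) (hr : r < ρ)
    (hs : tsupport ψ ⊆ tubeMap γ (ς * I * γ' s₀) '' rect s₀ r) :
    ∫ z in Ω, F z * dbar ψ z = ∫ w in upperRect s₀ r,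
      ((ς * (ς * (γ' w.re * (starRingEnd ℂ) (γ' s₀)).re) : ℝ) : ℂ) *
        (F (tubeMap γ (ς * I * γ' s₀) w) * dbar ψ (tubeMap γ (ς * I * γ' s₀) w)) := by
  have hsub : upperRect s₀ r ⊆ {w | |w.re - s₀| < δ} :=
    ((upperRect_subset s₀ r).trans (rect_mono hr.le)).trans ch.rect_subset
  rw [setIntegral_eq_of_subset_of_forall_sdiff_eq_zero
    (s := tubeMap γ (ς * I * γ' s₀) '' upperRect s₀ r) h.isOpen.measurableSet,
    integral_image_eq_integral_abs_det_fderiv_smul volume (isOpen_upperRect s₀ r).measurableSet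
      (fun w _ => (h.hasStrictFDerivAt_tubeMap _ w).hasFDerivAt.hasFDerivWithinAt)
      ((ch.injOn h o.abs_eq_one).mono hsub)]
  · refine setIntegral_congr_fun (isOpen_upperRect s₀ r).measurableSet fun w hw => ?_
    have hp := h.re_mul_conj_pos (ch.deriv_close _ (hsub hw))
    have hς2 : ς * ς = 1 := by rw [← abs_mul_abs_self, o.abs_eq_one, one_mul]
    simp only [tubeDeriv_det_eq, abs_mul, o.abs_eq_one, one_mul, abs_of_pos hp, real_smul,
      ← mul_assoc, hς2]
  · rintro _ ⟨w, hw, rfl⟩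
    exact o.image_upperRect_subset h ch (rect_mono hr.le (upperRect_subset _ _ hw)) hw.2.1
  · rintro z ⟨hz, hz'⟩
    rw [dbar_eq_zero_of_notMem_tsupport, mul_zero]
    intro hm
    obtain ⟨w, hw, rfl⟩ := hs hm
    exact hz' ⟨w, ⟨hw.1, (o.mem_iff h ch (rect_mono hr.le hw)).1 hz, (abs_lt.1 hw.2).2⟩, rfl⟩

lemma IsOuterSide.greenFor_of_tsupport_subset (o : IsOuterSide Ω γ γ' ς U)
    (h : IsBoundaryCurve Ω γ γ') (hFc : Continuous F) (hFd : DifferentiableOn ℂ F Ω)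
    (hψ : ContDiff ℝ 1 ψ) {s₀ δ ρ r : ℝ} (ch : IsChart γ γ' s₀ δ ρ) (hr0 : 0 < r) (hr : r < ρ)
    (hs : tsupport ψ ⊆ tubeMap γ (ς * I * γ' s₀) '' rect s₀ r) : GreenFor Ω γ γ' ς F ψ := by
  obtain ⟨κ, hκ⟩ : ∃ κ, κ = ς * I * γ' s₀ := ⟨_, rfl⟩
  have hT := h.continuous_tubeMap κ
  have hg := h.continuous_deriv
  have hψc := hψ.continuous
  have hdb := continuous_dbar hψ
  have hmemρ : ∀ s ∈ Icc (s₀ - r) (s₀ + r), ∀ y ∈ Icc 0 r, (s + y * I : ℂ) ∈ rect s₀ ρ := by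
    intro s hs y hy
    refine ⟨?_, ?_⟩
    · simp only [add_re, ofReal_re, mul_re, I_re, mul_zero, ofReal_im, I_im, mul_one, sub_self,
        add_zero]
      exact abs_lt.2 ⟨by linarith [hs.1], by linarith [hs.2]⟩
    · simp only [add_im, ofReal_im, mul_im, ofReal_re, I_im, mul_one, I_re, mul_zero, add_zero,
        zero_add]
      exact abs_lt.2 ⟨by linarith [hy.1], by linarith [hy.2]⟩
  have hΩ : ∀ w ∈ Icc (s₀ - r) (s₀ + r) ×ℂ Ioo 0 r, tubeMap γ κ w ∈ Ω := by
    intro w hw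
    have hw := Complex.mem_reProdIm.1 hw
    have := hmemρ w.re hw.1 w.im (Ioo_subset_Icc_self hw.2)
    rw [re_add_im] at this
    rw [hκ]
    exact o.image_upperRect_subset h ch this hw.2.1
  have hmem : ∀ s ∈ Icc (s₀ - r) (s₀ + r), ∀ y ∈ Ioo 0 r,
      (s + y * I : ℂ) ∈ Icc (s₀ - r) (s₀ + r) ×ℂ Ioo 0 r := fun s hs y hy =>
    Complex.mem_reProdIm.2 ⟨by simpa using hs, by simpa using hy⟩
  have hzero : ∀ s ∈ Icc (s₀ - r) (s₀ + r), ∀ y ∈ Icc 0 r, (s + y * I : ℂ) ∉ rect s₀ r →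
      F (tubeMap γ κ (s + y * I)) * (ψ (tubeMap γ κ (s + y * I)) : ℂ) = 0 := by
    intro s hs' y hy hn
    rw [hκ, image_eq_zero_of_notMem_tsupport
      (ch.apply_notMem_tsupport h o.abs_eq_one hr.le hs (hmemρ s hs' y hy) hn)]
    simp
  have hP : ∀ w ∈ Icc (s₀ - r) (s₀ + r) ×ℂ Ioo 0 r,
      HasFDerivAt (fun w => F (tubeMap γ κ w) * (ψ (tubeMap γ κ w) : ℂ))
        ((F (tubeMap γ κ w) • (ofRealCLM.comp (fderiv ℝ ψ (tubeMap γ κ w))) +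
        (ψ (tubeMap γ κ w) : ℂ) • ((ContinuousLinearMap.toSpanSingleton ℂ
          (deriv F (tubeMap γ κ w))).restrictScalars ℝ)).comp (tubeDeriv γ' κ w)) w := fun w hw =>
    (hasFDerivAt_mul_ofReal (hFd.differentiableAt (h.isOpen.mem_nhds (hΩ w hw))).hasDerivAt
      (hψ.differentiable one_ne_zero _)).comp w (h.hasStrictFDerivAt_tubeMap κ w).hasFDerivAt
  have hcF' : ContinuousOn (fun w => deriv F (tubeMap γ κ w))
      (Icc (s₀ - r) (s₀ + r) ×ℂ Ioo 0 r) :=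
    (hFd.deriv h.isOpen).continuousOn.comp hT.continuousOn hΩ
  have hcψ' : ∀ v : ℂ → ℂ, Continuous v → Continuous fun w => fderiv ℝ ψ (tubeMap γ κ w) (v w) :=
    fun v hv => ((hψ.continuous_fderiv one_ne_zero).comp hT).clm_apply hv
  have hcP : ∀ v : ℂ → ℂ, Continuous v → ContinuousOn (fun w => F (tubeMap γ κ w) *
      (fderiv ℝ ψ (tubeMap γ κ w) (v w) : ℂ) + (ψ (tubeMap γ κ w) : ℂ) *
      (deriv F (tubeMap γ κ w) * v w)) (Icc (s₀ - r) (s₀ + r) ×ℂ Ioo 0 r) := fun v hv => by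
    have := hcψ' v hv
    refine ContinuousOn.add (Continuous.continuousOn (by fun_prop)) (ContinuousOn.mul
      (Continuous.continuousOn (by fun_prop)) (hcF'.mul hv.continuousOn))
  have main := integral_eq_neg_integral_rectangle (a := s₀ - r) (b := s₀ + r) (r := r) (g := γ')
    (κ := κ) (P := fun w => F (tubeMap γ κ w) * (ψ (tubeMap γ κ w) : ℂ))
    (P₁ := fun w => F (tubeMap γ κ w) * (fderiv ℝ ψ (tubeMap γ κ w) (γ' w.re) : ℂ) +
      (ψ (tubeMap γ κ w) : ℂ) * (deriv F (tubeMap γ κ w) * γ' w.re))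
    (P₂ := fun w => F (tubeMap γ κ w) * (fderiv ℝ ψ (tubeMap γ κ w) κ : ℂ) +
      (ψ (tubeMap γ κ w) : ℂ) * (deriv F (tubeMap γ κ w) * κ))
    (Q := fun w => (-I * ς) * (((ς * (ς * (γ' w.re * (starRingEnd ℂ) (γ' s₀)).re) : ℝ) : ℂ) *
        (F (tubeMap γ κ w) * dbar ψ (tubeMap γ κ w)))) (by linarith) hr0 hg (by fun_prop)
    (by fun_prop) ?_ ?_ (hcP (fun w => γ' w.re) (by fun_prop)) (hcP (fun _ => κ) (by fun_prop))
    ?_ ?_ ?_ ?_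
  · rw [GreenFor, ch.integral_curve_eq h o.abs_eq_one hr0 hr hs, o.setIntegral_eq h ch hr hs,
      ← hκ]
    have hγT : ∀ t : ℝ, tubeMap γ κ t = γ t := fun t => by simp [tubeMap]
    simp only [hγT] at main
    rw [main, upperRect_eq, ← setIntegral_reProdIm (by linarith) hr0.le
      (Q := fun w => (-I * ς) * (((ς * (ς * (γ' w.re * (starRingEnd ℂ) (γ' s₀)).re) : ℝ) : ℂ) *
        (F (tubeMap γ κ w) * dbar ψ (tubeMap γ κ w)))) (by fun_prop),
      integral_const_mul]
    ring
  · intro s hs' y hy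
    have h1 := hP _ (hmem s hs' y hy)
    have h2 : HasDerivAt (fun s : ℝ => (s + y * I : ℂ)) 1 s :=
      (ofRealCLM.hasDerivAt (x := s)).add_const _
    refine (h1.comp_hasDerivAt s h2).congr_deriv ?_
    simp [tubeDeriv]
    exact Or.inl (mul_comm _ _)
  · intro s hs' y hy
    have h1 := hP _ (hmem s hs' y hy)
    have h2 : HasDerivAt (fun y : ℝ => (s + y * I : ℂ)) I y := by
      simpa using ((ofRealCLM.hasDerivAt (x := y)).mul_const I).const_add (s : ℂ)
    refine (h1.comp_hasDerivAt y h2).congr_deriv ?_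
    simp [tubeDeriv]
    exact Or.inl (mul_comm _ _)
  · intro s hs' y hy
    have e1 := fderiv_mul_sub_fderiv_mul (ψ := ψ) (γ' s) κ (tubeMap γ κ (s + y * I))
    have e2 : (γ' s).re * κ.im - (γ' s).im * κ.re =
        ς * (γ' s * (starRingEnd ℂ) (γ' s₀)).re := by
      rw [hκ]; simp; ring
    have hς2 : (ς : ℂ) * ς = 1 := by
      have : ς * ς = 1 := by rw [← abs_mul_abs_self, o.abs_eq_one, one_mul]
      exact_mod_cast this
    rw [e2] at e1
    have e3 : (s + y * I : ℂ).re = s := by simp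
    simp only [e3]
    push_cast at e1 ⊢
    linear_combination F (tubeMap γ κ (s + y * I)) * e1 +
      I * ς * ((γ' s * (starRingEnd ℂ) (γ' s₀)).re : ℂ) * (F (tubeMap γ κ (s + y * I)) *
        dbar ψ (tubeMap γ κ (s + y * I))) * hς2
  · exact fun y hy => by
      have := hzero (s₀ - r) ⟨le_rfl, by linarith⟩ y (Ioo_subset_Icc_self hy)
        fun hm => by have := hm.1; simp [abs_of_pos hr0] at this
      exact_mod_cast this
  · exact fun y hy => by
      have := hzero (s₀ + r) ⟨by linarith, le_rfl⟩ y (Ioo_subset_Icc_self hy)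
        fun hm => by have := hm.1; simp [abs_of_pos hr0] at this
      exact_mod_cast this
  · exact fun s hs' => hzero s hs' r ⟨hr0.le, le_rfl⟩
      fun hm => by have := hm.2; simp [abs_of_pos hr0] at this

end IsBoundaryCurve

namespace IsBoundaryCurve

open scoped Manifold ContDiff

variable {Ω U : Set ℂ} {γ γ' : ℝ → ℂ} {ς : ℝ} {F : ℂ → ℂ} {ψ φ : ℂ → ℝ}

lemma greenFor_congr (h : IsBoundaryCurve Ω γ γ') (e : EqOn ψ φ (closure Ω))
    (hψ : GreenFor Ω γ γ' ς F ψ) : GreenFor Ω γ γ' ς F φ := by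
  unfold GreenFor at hψ ⊢
  have e1 : ∫ z in Ω, F z * dbar φ z = ∫ z in Ω, F z * dbar ψ z := by
    refine setIntegral_congr_fun h.isOpen.measurableSet fun z hz => ?_
    have : φ =ᶠ[𝓝 z] ψ := by
      filter_upwards [h.isOpen.mem_nhds hz] with w hw
      exact (e (subset_closure hw)).symm
    simp only [dbar_congr this]
  rw [e1, ← hψ]
  refine intervalIntegral.integral_congr fun t ht => ?_
  rw [uIcc_of_le two_pi_nonneg] at ht
  simp only [e (frontier_subset_closure (h.mem_frontier ht))]

lemma isCompact_closure (h : IsBoundaryCurve Ω γ γ') : IsCompact (closure Ω) :=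
  Metric.isCompact_of_isClosed_isBounded isClosed_closure h.isBounded.closure

lemma integrableOn_of_continuous (h : IsBoundaryCurve Ω γ γ') {g : ℂ → ℂ} (hg : Continuous g) :
    IntegrableOn g Ω :=
  (hg.continuousOn.integrableOn_compact h.isCompact_closure).mono_set subset_closure

lemma greenFor_sum (h : IsBoundaryCurve Ω γ γ') (hFc : Continuous F) {ι : Type*} [Fintype ι]
    {ψ : ι → ℂ → ℝ} (hc : ∀ i, ContDiff ℝ 1 (ψ i)) (hψ : ∀ i, GreenFor Ω γ γ' ς F (ψ i)) :
    GreenFor Ω γ γ' ς F fun z => ∑ i, ψ i z := by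
  unfold GreenFor at hψ ⊢
  have hγ := h.continuous
  have hγ' := h.continuous_deriv
  have e : ∀ z, dbar (fun z => ∑ i, ψ i z) z = ∑ i, dbar (ψ i) z := fun z => by
    rw [dbar, fderiv_fun_sum fun i _ => (hc i).differentiable one_ne_zero z]
    simp only [_root_.sum_apply, ofReal_sum, Finset.mul_sum, ← Finset.sum_add_distrib]
    rfl
  simp only [e, ofReal_sum, Finset.mul_sum, Finset.sum_mul]
  rw [intervalIntegral.integral_finsetSum, integral_finsetSum, Finset.mul_sum]
  · exact Finset.sum_congr rfl fun i _ => hψ i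
  · exact fun i _ => h.integrableOn_of_continuous (hFc.mul (continuous_dbar (hc i)))
  · intro i _
    have := (hc i).continuous
    exact Continuous.intervalIntegrable (by fun_prop) _ _

lemma IsOuterSide.greenFor_of_notMem_tsupport (o : IsOuterSide Ω γ γ' ς U)
    (h : IsBoundaryCurve Ω γ γ') (hFc : Continuous F) (hFd : DifferentiableOn ℂ F Ω)
    (hψ : ContDiff ℝ 1 ψ) (h0 : γ 0 ∉ tsupport ψ) : GreenFor Ω γ γ' ς F ψ := by
  choose! δ ρ ch using fun s (hs : s ∈ Ioo 0 (2 * π)) => h.exists_isChart hs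
  let V : Option (Ioo 0 (2 * π)) → Set ℂ := fun i => i.elim Ω
    fun s => tubeMap γ (ς * I * γ' s) '' rect s (ρ s / 2)
  have hV : ∀ i, IsOpen (V i) := by
    rintro (_ | s)
    · exact h.isOpen
    · have := (ch s s.2).rho_pos
      exact (ch s s.2).isOpen_image h o.abs_eq_one (isOpen_rect _ _)
        ((rect_mono (by linarith)).trans (ch s s.2).rect_subset)
  have hK : IsCompact (closure Ω ∩ tsupport ψ) := h.isCompact_closure.inter_right
    (isClosed_tsupport ψ)
  have hcov : closure Ω ∩ tsupport ψ ⊆ ⋃ i, V i := by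
    rintro z ⟨hz, hz'⟩
    by_cases hzΩ : z ∈ Ω
    · exact mem_iUnion.2 ⟨none, hzΩ⟩
    · have hzf : z ∈ frontier Ω := h.isOpen.frontier_eq ▸ ⟨hz, hzΩ⟩
      obtain ⟨s, hs, rfl⟩ := h.exists_eq_of_mem_frontier hzf fun e => h0 (e ▸ hz')
      have := (ch s hs).rho_pos
      exact mem_iUnion.2 ⟨some ⟨s, hs⟩, s, IsChart.self_mem_rect (by simpa using by linarith),
        by simp [tubeMap]⟩
  obtain ⟨t, ht⟩ := hK.elim_finite_subcover V hV hcov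
  obtain ⟨f, hf⟩ := SmoothPartitionOfUnity.exists_isSubordinate 𝓘(ℝ, ℂ) hK.isClosed
    (fun i : t => V i) (fun i => hV i) (fun z hz => by simpa using ht hz)
  have hfc : ∀ i : t, ContDiff ℝ 1 fun z => f i z * ψ z := fun i =>
    (((f i).contMDiff.contDiff).of_le (by exact_mod_cast le_top)).mul hψ
  have hsub : ∀ i : t, tsupport (fun z => f i z * ψ z) ⊆ V i := fun i =>
    (tsupport_mul_subset_left).trans (hf i)
  refine h.greenFor_congr ?_ (h.greenFor_sum hFc hfc ?_)
  · intro z hz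
    simp only [← Finset.sum_mul]
    by_cases hz' : z ∈ tsupport ψ
    · have := f.sum_eq_one ⟨hz, hz'⟩
      rw [finsum_eq_sum_of_fintype] at this
      rw [this, one_mul]
    · rw [image_eq_zero_of_notMem_tsupport hz', mul_zero]
  · rintro ⟨_ | s, hi⟩
    · exact h.greenFor_of_tsupport_subset hFd (hfc _) (hsub _)
    · have := (ch s s.2).rho_pos
      exact o.greenFor_of_tsupport_subset h hFc hFd (hfc _) (ch s s.2) (r := ρ s / 2)
        (by linarith) (by linarith) (hsub ⟨some s, hi⟩)

end IsBoundaryCurve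

/-- A cutoff function vanishing near `p` and equal to `1` outside the ball of radius `2 / n`. -/
def puncture (p : ℂ) (n : ℝ) (z : ℂ) : ℝ :=
  1 - (⟨1, 2, one_pos, one_lt_two⟩ : ContDiffBump (0 : ℂ)) (n • (z - p))

lemma contDiff_puncture (p : ℂ) (n : ℝ) : ContDiff ℝ 1 (puncture p n) := by
  unfold puncture
  refine contDiff_const.sub ((ContDiffBump.contDiff _).comp ?_)
  fun_prop

lemma abs_puncture_le_one (p : ℂ) (n : ℝ) (z : ℂ) : |puncture p n z| ≤ 1 := by
  obtain ⟨β, hβ⟩ : ∃ β : ContDiffBump (0 : ℂ), β = ⟨1, 2, one_pos, one_lt_two⟩ := ⟨_, rfl⟩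
  have h1 := β.nonneg (x := n • (z - p))
  have h2 := β.le_one (x := n • (z - p))
  rw [puncture, ← hβ, abs_le]
  constructor <;> linarith

lemma puncture_eq_one {p : ℂ} {n : ℝ} (hn : 0 < n) {z : ℂ} (hz : 2 / n ≤ ‖z - p‖) :
    puncture p n z = 1 := by
  rw [puncture, ContDiffBump.zero_of_le_dist, sub_zero]
  rw [div_le_iff₀ hn] at hz
  rw [dist_zero_right, norm_smul, Real.norm_eq_abs, abs_of_pos hn]
  linarith

lemma notMem_tsupport_puncture {p : ℂ} {n : ℝ} (hn : 0 < n) : p ∉ tsupport (puncture p n) := by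
  rw [notMem_tsupport_iff_eventuallyEq]
  filter_upwards [Metric.ball_mem_nhds p (show 0 < 1 / n by positivity)] with z hz
  rw [puncture, ContDiffBump.one_of_mem_closedBall, sub_self, Pi.zero_apply]
  rw [Metric.mem_ball, dist_eq_norm, lt_div_iff₀ hn] at hz
  rw [mem_closedBall_zero_iff, norm_smul, Real.norm_eq_abs, abs_of_pos hn]
  linarith

lemma exists_norm_dbar_puncture_le (p : ℂ) :
    ∃ C, 0 ≤ C ∧ ∀ n : ℝ, 0 < n → ∀ z, ‖dbar (puncture p n) z‖ ≤ C * n := by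
  obtain ⟨β, hβ⟩ : ∃ β : ContDiffBump (0 : ℂ), β = ⟨1, 2, one_pos, one_lt_two⟩ := ⟨_, rfl⟩
  have hβd : ContDiff ℝ 1 β := β.contDiff
  obtain ⟨C, hC⟩ := (hβd.continuous_fderiv one_ne_zero).bounded_above_of_compact_support
    (β.hasCompactSupport.fderiv ℝ)
  have hC0 : 0 ≤ C := (norm_nonneg _).trans (hC 0)
  refine ⟨2 * C, by positivity, fun n hn z => ?_⟩
  have hfd : fderiv ℝ (puncture p n) z =
      -((fderiv ℝ β (n • (z - p))).comp (n • ContinuousLinearMap.id ℝ ℂ)) := by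
    have h1 : HasFDerivAt (fun z : ℂ => n • (z - p)) (n • ContinuousLinearMap.id ℝ ℂ) z :=
      ((hasFDerivAt_id z).sub_const p).const_smul n
    have h2 := ((hβd.differentiable one_ne_zero (n • (z - p))).hasFDerivAt.comp z h1).const_sub 1
    rw [← h2.fderiv]
    congr 1
    funext w
    rw [puncture, hβ]; rfl
  have hb : ∀ v : ℂ, ‖v‖ = 1 → ‖(fderiv ℝ (puncture p n) z v : ℂ)‖ ≤ C * n := by
    intro v hv
    rw [Complex.norm_real, hfd, _root_.neg_apply, norm_neg]
    refine ((fderiv ℝ β (n • (z - p))).le_opNorm _).trans ?_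
    have : ‖(n • ContinuousLinearMap.id ℝ ℂ) v‖ = n := by
      rw [_root_.smul_apply, norm_smul, ContinuousLinearMap.id_apply, hv, mul_one,
        Real.norm_eq_abs, abs_of_pos hn]
    exact mul_le_mul (hC _) this.le (norm_nonneg _) hC0
  refine (norm_add_le _ _).trans ?_
  rw [norm_mul, norm_I, one_mul]
  have h1 := hb 1 (by simp)
  have h2 := hb I (by simp)
  linarith

lemma dbar_puncture_eq_zero {p : ℂ} {n : ℝ} (hn : 0 < n) {z : ℂ} (hz : 2 / n < ‖z - p‖) :
    dbar (puncture p n) z = 0 := by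
  have : puncture p n =ᶠ[𝓝 z] fun _ => 1 := by
    have ho : IsOpen {w : ℂ | 2 / n < ‖w - p‖} := isOpen_lt continuous_const (by fun_prop)
    filter_upwards [ho.mem_nhds hz] with w hw
    exact puncture_eq_one hn (le_of_lt hw)
  rw [dbar_congr this, dbar]; simp

lemma tendsto_integral_dbar_puncture {Ω : Set ℂ} (hΩ : MeasurableSet Ω) {F : ℂ → ℂ} {M : ℝ}
    (hM : ∀ z ∈ Ω, ‖F z‖ ≤ M) (p : ℂ) :
    Tendsto (fun n : ℕ => ∫ z in Ω, F z * dbar (puncture p n) z) atTop (𝓝 0) := by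
  obtain ⟨C, hC0, hC⟩ := exists_norm_dbar_puncture_le p
  have hlim : Tendsto (fun n : ℕ => max M 0 * C * 4 * π / (n : ℝ)) atTop (𝓝 0) :=
    tendsto_const_nhds.div_atTop tendsto_natCast_atTop_atTop
  refine squeeze_zero_norm' ?_ hlim
  filter_upwards [eventually_gt_atTop 0] with n hn
  have hn : (0 : ℝ) < n := by exact_mod_cast hn
  rw [setIntegral_eq_of_subset_of_forall_sdiff_eq_zero (s := Ω ∩ Metric.closedBall p (2 / n)) hΩ
    inter_subset_left]
  · have hfin : volume (Metric.closedBall p (2 / (n : ℝ))) < ⊤ := measure_closedBall_lt_top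
    have h1 := norm_setIntegral_le_of_norm_le_const (μ := volume)
      (s := Ω ∩ Metric.closedBall p (2 / n)) (f := fun z => F z * dbar (puncture p n) z)
      (C := max M 0 * (C * n)) ((measure_mono inter_subset_right).trans_lt hfin)
      (fun z hz => by
        rw [norm_mul]
        gcongr
        · exact (hM z hz.1).trans (le_max_left _ _)
        · exact hC n hn z)
    have h2 : volume.real (Ω ∩ Metric.closedBall p (2 / n)) ≤ (2 / n) ^ 2 * π := by
      refine (measureReal_mono inter_subset_right hfin.ne).trans ?_
      rw [Measure.real, Complex.volume_closedBall, ENNReal.toReal_mul, ENNReal.toReal_pow,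
        ENNReal.toReal_ofReal (by positivity)]
      rfl
    refine h1.trans ((mul_le_mul_of_nonneg_left h2 (by positivity)).trans (le_of_eq ?_))
    field_simp
    ring
  · rintro z ⟨hz, hz'⟩
    rw [dbar_puncture_eq_zero hn, mul_zero]
    by_contra hcon
    exact hz' ⟨hz, by rw [Metric.mem_closedBall, dist_eq_norm]; exact not_lt.1 hcon⟩

namespace IsBoundaryCurve

variable {Ω U : Set ℂ} {γ γ' : ℝ → ℂ} {F : ℂ → ℂ}

lemma tendsto_integral_puncture (h : IsBoundaryCurve Ω γ γ') (hFc : Continuous F) :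
    Tendsto (fun n : ℕ => ∫ t in (0 : ℝ)..(2 * π), F (γ t) * puncture (γ 0) n (γ t) * γ' t) atTop
      (𝓝 (∫ t in (0 : ℝ)..(2 * π), F (γ t) * γ' t)) := by
  have hγ := h.continuous
  have hγ' := h.continuous_deriv
  refine intervalIntegral.tendsto_integral_filter_of_dominated_convergence
    (fun t => ‖F (γ t) * γ' t‖) ?_ ?_ ?_ ?_
  · refine .of_forall fun n => Continuous.aestronglyMeasurable ?_
    have := (contDiff_puncture (γ 0) n).continuous
    fun_prop
  · refine .of_forall fun n => .of_forall fun t _ => ?_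
    rw [norm_mul, norm_mul, norm_mul, Complex.norm_real, Real.norm_eq_abs]
    have := abs_puncture_le_one (γ 0) n (γ t)
    gcongr
    exact mul_le_of_le_one_right (norm_nonneg _) this
  · exact Continuous.intervalIntegrable (by fun_prop) _ _
  · have hae : ∀ᵐ t : ℝ, t ≠ 2 * π := by simp [ae_iff, measure_singleton]
    filter_upwards [hae] with t ht ht'
    rw [uIoc_of_le two_pi_nonneg] at ht'
    have hne : γ t ≠ γ 0 := fun e => ht'.1.ne'
      (h.injOn ⟨ht'.1.le, lt_of_le_of_ne ht'.2 ht⟩ ⟨le_rfl, by positivity⟩ e)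
    have hpos : 0 < ‖γ t - γ 0‖ := norm_pos_iff.2 (sub_ne_zero.2 hne)
    have hlim : Tendsto (fun n : ℕ => 2 / (n : ℝ)) atTop (𝓝 0) :=
      tendsto_const_nhds.div_atTop tendsto_natCast_atTop_atTop
    refine tendsto_const_nhds.congr' ?_
    filter_upwards [hlim.eventually_le_const hpos, eventually_gt_atTop 0] with n hn hn0
    rw [puncture_eq_one (by exact_mod_cast hn0) hn, ofReal_one, mul_one]

/-- **Cauchy's theorem** for functions holomorphic in the domain and continuous up to the
boundary. -/
theorem integral_eq_zero (h : IsBoundaryCurve Ω γ γ') (hFc : ContinuousOn F (closure Ω))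
    (hFd : DifferentiableOn ℂ F Ω) : ∫ t in (0 : ℝ)..(2 * π), F (γ t) * γ' t = 0 := by
  obtain ⟨ς, U, o⟩ := h.exists_isOuterSide
  obtain ⟨G, hG⟩ := ContinuousMap.exists_restrict_eq isClosed_closure
    (⟨(closure Ω).domRestrict F, hFc.domRestrict⟩ : C(closure Ω, ℂ))
  have hGF : EqOn G F (closure Ω) := fun z hz => congrArg (fun g => g ⟨z, hz⟩) hG
  have hGd : DifferentiableOn ℂ G Ω := hFd.congr fun z hz => hGF (subset_closure hz)
  have hGc : Continuous G := G.continuous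
  have e : ∫ t in (0 : ℝ)..(2 * π), F (γ t) * γ' t = ∫ t in (0 : ℝ)..(2 * π), G (γ t) * γ' t := by
    refine intervalIntegral.integral_congr fun t ht => ?_
    rw [uIcc_of_le two_pi_nonneg] at ht
    simp only [hGF (frontier_subset_closure (h.mem_frontier ht))]
  obtain ⟨M, hM⟩ := h.isCompact_closure.exists_bound_of_continuousOn hGc.continuousOn
  have h1 := (tendsto_integral_dbar_puncture h.isOpen.measurableSet
    (fun z hz => hM z (subset_closure hz)) (γ 0)).const_mul (ς * I)
  rw [mul_zero] at h1
  rw [e]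
  refine tendsto_nhds_unique (h.tendsto_integral_puncture hGc) (h1.congr' ?_)
  filter_upwards [eventually_gt_atTop 0] with n hn
  exact (o.greenFor_of_notMem_tsupport h hGc hGd (contDiff_puncture _ _)
    (notMem_tsupport_puncture (by exact_mod_cast hn))).symm

end IsBoundaryCurve

lemma exists_hasDerivAt_extension {γ : ℝ → ℂ} {a b : ℝ} (hab : a < b)
    (hγ : ContDiffOn ℝ 1 γ (Icc a b)) (hreg : ∀ t ∈ Icc a b, derivWithin γ (Icc a b) t ≠ 0) :
    ∃ γ₁ γ₁' : ℝ → ℂ, (∀ t, HasDerivAt γ₁ (γ₁' t) t) ∧ Continuous γ₁' ∧ (∀ t, γ₁' t ≠ 0) ∧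
      EqOn γ₁ γ (Icc a b) ∧ EqOn γ₁' (derivWithin γ (Icc a b)) (Icc a b) := by
  have hc : ContinuousOn (derivWithin γ (Icc a b)) (Icc a b) :=
    hγ.continuousOn_derivWithin (uniqueDiffOn_Icc hab) le_rfl
  set γ₁' := IccExtend hab.le ((Icc a b).domRestrict (derivWithin γ (Icc a b))) with hγ₁'
  have hc' : Continuous γ₁' := hc.domRestrict.Icc_extend'
  have he : EqOn γ₁' (derivWithin γ (Icc a b)) (Icc a b) := fun t ht => by
    rw [hγ₁', IccExtend_of_mem _ _ ht, domRestrict_apply]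
  have hd : ∀ t, HasDerivAt (fun t => γ a + ∫ u in a..t, γ₁' u) (γ₁' t) t := fun t =>
    (intervalIntegral.integral_hasDerivAt_right (hc'.intervalIntegrable _ _)
      hc'.stronglyMeasurable.stronglyMeasurableAtFilter hc'.continuousAt).const_add _
  refine ⟨_, γ₁', hd, hc', fun t => hreg _ (projIcc a b hab.le t).2, fun t ht => ?_, he⟩
  have hii : ∫ u in a..t, γ₁' u = γ t - γ a := by
    refine intervalIntegral.integral_eq_sub_of_hasDerivAt_of_le ht.1
      (hγ.continuousOn.mono (Icc_subset_Icc_right ht.2)) (fun u hu => ?_)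
      (hc'.intervalIntegrable _ _)
    have hu' : u ∈ Ioo a b := ⟨hu.1, hu.2.trans_le ht.2⟩
    rw [he (Ioo_subset_Icc_self hu')]
    exact (hγ.differentiableOn one_ne_zero u (Ioo_subset_Icc_self hu')).hasDerivWithinAt.hasDerivAt
      (Icc_mem_nhds hu'.1 hu'.2)
  simp only [hii]; ring

end

/-- A continuous function on the `C¹` simple closed boundary curve of a
bounded domain `Ω ⊂ ℂ` extends holomorphically to `Ω` if and only if it satisfies the
moment conditions `∫ z^m f(z) dz = 0` for all `m ≥ 0`. -/
theorem holomorphic_extension_iff_moment_conditions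
    (Ω : Set ℂ) (hΩo : IsOpen Ω) (hΩc : IsConnected Ω) (hΩb : Bornology.IsBounded Ω)
    (γ : ℝ → ℂ)
    (hγC1 : ContDiffOn ℝ 1 γ (Icc 0 (2 * π)))
    (hclosed : γ 0 = γ (2 * π))
    (hinj : InjOn γ (Ico 0 (2 * π)))
    (hreg : ∀ θ ∈ Icc (0:ℝ) (2 * π), derivWithin γ (Icc 0 (2 * π)) θ ≠ 0)
    (himg : γ '' Icc 0 (2 * π) = frontier Ω)
    (f : ℂ → ℂ) (hf : ContinuousOn f (frontier Ω)) :
    (∃ F : ℂ → ℂ, ContinuousOn F (closure Ω) ∧ DifferentiableOn ℂ F Ω ∧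
        EqOn F f (frontier Ω)) ↔
      ∀ m : ℕ, (∫ θ in (0:ℝ)..(2 * π),
        γ θ ^ m * f (γ θ) * derivWithin γ (Icc 0 (2 * π)) θ) = 0 := by
  obtain ⟨γ₁, γ₁', hd, hc, hne, he, he'⟩ := exists_hasDerivAt_extension two_pi_pos hγC1 hreg
  have h : IsBoundaryCurve Ω γ₁ γ₁' :=
    { isOpen := hΩo
      isConnected := hΩc
      isBounded := hΩb
      hasDerivAt := hd
      continuous_deriv := hc
      deriv_ne_zero := hne
      closed := by
        rw [he (left_mem_Icc.2 two_pi_pos.le), he (right_mem_Icc.2 two_pi_pos.le), hclosed]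
      injOn := hinj.congr (he.mono Ico_subset_Icc_self).symm
      image_eq := he.image_eq.trans himg }
  have hm (m : ℕ) : ∫ θ in (0:ℝ)..(2 * π), γ θ ^ m * f (γ θ) * derivWithin γ (Icc 0 (2 * π)) θ =
      ∫ t in (0:ℝ)..(2 * π), γ₁ t ^ m * (f (γ₁ t) * γ₁' t) := by
    refine intervalIntegral.integral_congr fun t ht => ?_
    rw [uIcc_of_le two_pi_pos.le] at ht
    simp only [he ht, he' ht, mul_assoc]
  refine ⟨fun ⟨F, hFc, hFd, hFf⟩ m => ?_, fun H => h.exists_extension hf fun m => hm m ▸ H m⟩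
  rw [hm, ← h.integral_eq_zero (F := fun z => z ^ m * F z) ((continuousOn_id.pow m).mul hFc)
    ((differentiableOn_id.pow m).mul hFd)]
  refine intervalIntegral.integral_congr fun t ht => ?_
  rw [uIcc_of_le two_pi_pos.le] at ht
  have hfr : γ₁ t ∈ frontier Ω := h.image_eq ▸ mem_image_of_mem _ ht
  simp only [hFf hfr, mul_assoc]
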